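/- arXiv:2408.14557 — 5 statements merged into one kernel-verified Lean document; each statement's English description precedes it below -/
import Mathlib

section
/- If a vgr(v,k,g,λ)-graph exists (for some integers v, k ≥ 2, g ≥ 3, λ ≥ 1), then there exist infinitely many integers v′ such that a vgr(v′, k+1, g, λ)-graph exists. -/
open SimpleGraph

/-- The number of closed walks based at `u` of length `g` that are cycles.
Since each (unoriented, basepoint-free) cycle of length `g ≥ 3` through `u`
corresponds to exactly two such closed walks (one for each orientation), this
equals twice the number of cycles of length `g` containing `u`. -/
noncomputable def vertexCycleCount {V : Type*} (G : SimpleGraph V) (g : ℕ) (u : V) : ℕ :=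
  Nat.card {p : G.Walk u u // p.IsCycle ∧ p.length = g}

/-- `IsVGR G v k g lam` says that `G` is a vertex-girth-regular
`vgr(v,k,g,lam)`-graph: a finite simple `k`-regular graph of girth `g` on `v`
vertices in which every vertex lies on exactly `lam` cycles of length `g`
(encoded as: `2 * lam` closed cycle-walks based at each vertex). -/
def IsVGR {V : Type*} (G : SimpleGraph V) (v k g lam : ℕ) : Prop :=
  Finite V ∧ Nat.card V = v ∧ (∀ u : V, Nat.card (G.neighborSet u) = k) ∧
    G.girth = (g : ℕ∞) ∧ ∀ u : V, vertexCycleCount G g u = 2 * lam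

/-- Reduced words of length at most `g` over the alphabet `V`. -/
abbrev ReducedWord (V : Type) (g : ℕ) : Type :=
  {l : List V // l.IsChain (· ≠ ·) ∧ l.length ≤ g}

lemma ReducedWord.finite (V : Type) [Finite V] (g : ℕ) : Finite (ReducedWord V g) :=
  ((List.finite_length_le V g).subset fun _ hl => hl.2).to_subtype

open Classical in
/-- Prepend the letter `u` to a word, cancelling it against an equal first letter; words of
length `g` that do not start with `u` are left alone. -/
noncomputable def toggleHead {V : Type} (g : ℕ) (u : V) (l : List V) : List V :=
  if l.head? = some u then l.tail else if l.length < g then u :: l else l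

lemma isChain_toggleHead {V : Type} {g : ℕ} (u : V) {l : List V} (hl : l.IsChain (· ≠ ·)) :
    (toggleHead g u l).IsChain (· ≠ ·) := by
  unfold toggleHead
  split_ifs with h₁ h₂
  · exact hl.tail
  · cases l with
    | nil => simp
    | cons a l => exact List.isChain_cons_cons.2 ⟨fun h => h₁ (by simp [h]), hl⟩
  · exact hl

lemma length_toggleHead_le {V : Type} {g : ℕ} (u : V) {l : List V} (hl : l.length ≤ g) :
    (toggleHead g u l).length ≤ g := by
  unfold toggleHead
  split_ifs <;> (try simp) <;> omega

lemma toggleHead_toggleHead {V : Type} {g : ℕ} (u : V) {l : List V}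
    (hl : l.IsChain (· ≠ ·)) (hg : l.length ≤ g) : toggleHead g u (toggleHead g u l) = l := by
  by_cases h₁ : l.head? = some u
  · obtain ⟨m, rfl⟩ : ∃ m, l = u :: m := by
      cases l <;> simp_all
    have h₂ : m.head? ≠ some u := by
      intro h
      cases m <;> simp_all
    have h₃ : m.length < g := by simpa using hg
    simp [toggleHead, h₂, h₃]
  · by_cases h₂ : l.length < g <;> simp [toggleHead, h₁, h₂]

/-- The involution of the set of reduced words that prepends or cancels the letter `u`. -/
noncomputable def toggleHeadPerm {V : Type} (g : ℕ) (u : V) : Equiv.Perm (ReducedWord V g) :=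
  Function.Involutive.toPerm
    (fun l => ⟨toggleHead g u l.1, isChain_toggleHead u l.2.1, length_toggleHead_le u l.2.2⟩)
    fun l => Subtype.ext (toggleHead_toggleHead u l.2.1 l.2.2)

lemma toggleHeadPerm_mul_self {V : Type} (g : ℕ) (u : V) :
    toggleHeadPerm g u * toggleHeadPerm g u = 1 :=
  Equiv.ext fun l => Subtype.ext (toggleHead_toggleHead u l.2.1 l.2.2)

lemma prod_toggleHeadPerm_nil {V : Type} {g : ℕ} (l : List V) (hl : l.IsChain (· ≠ ·))
    (hg : l.length ≤ g) :
    ((l.map (toggleHeadPerm g)).prod ⟨[], by simp⟩ : ReducedWord V g) = ⟨l, hl, hg⟩ := by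
  induction l with
  | nil => rfl
  | cons u l ih =>
    have h₁ : l.head? ≠ some u := by
      intro h
      cases l <;> simp_all
    have h₂ : l.length < g := by simpa using hg
    rw [List.map_cons, List.prod_cons, Equiv.Perm.mul_apply, ih hl.tail h₂.le]
    exact Subtype.ext (by simp [toggleHeadPerm, toggleHead, h₁, h₂])

/-- A family of involutions of `X` for which no nonempty reduced word of length at most `g` has
a fixed point. -/
structure IsFreeUpTo {V X : Type} (s : V → X → X) (g : ℕ) : Prop where
  involutive : ∀ u, Function.Involutive (s u)
  foldl_ne : ∀ l : List V, l.IsChain (· ≠ ·) → l ≠ [] → l.length ≤ g →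
    ∀ x, l.foldl (fun x u => s u x) x ≠ x

lemma isFreeUpTo_toggleHeadPerm (V ι : Type) (g : ℕ) :
    IsFreeUpTo (fun (u : V) (x : Equiv.Perm (ReducedWord V g) × ι) =>
      (x.1 * toggleHeadPerm g u, x.2)) g where
  involutive u x := by simp [mul_assoc, toggleHeadPerm_mul_self]
  foldl_ne l hl hne hg x h := by
    have key : ∀ (l : List V) (x : Equiv.Perm (ReducedWord V g) × ι),
        (l.foldl (fun x u => (x.1 * toggleHeadPerm g u, x.2)) x).1 =
          x.1 * (l.map (toggleHeadPerm g)).prod := by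
      intro l
      induction l with
      | nil => simp
      | cons u l ih => intro x; simp [ih, mul_assoc]
    have h₁ := key l x
    rw [h, left_eq_mul] at h₁
    have h₂ := prod_toggleHeadPerm_nil l hl hg
    rw [h₁] at h₂
    exact hne (congrArg Subtype.val h₂).symm

namespace IsFreeUpTo

variable {V X : Type} {s : V → X → X} {g : ℕ}

lemma apply_ne (hs : IsFreeUpTo s g) (hg : 1 ≤ g) (u : V) (x : X) : s u x ≠ x :=
  hs.foldl_ne [u] (by simp) (by simp) (by simpa using hg) x

/-- The disjoint union of copies of `G` indexed by `X`, where the vertex `u` of the copy `x` is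
joined to the vertex `u` of the copy `s u x`. -/
def matchedCopies (hs : IsFreeUpTo s g) (hg : 1 ≤ g) (G : SimpleGraph V) :
    SimpleGraph (V × X) where
  Adj a b := (a.2 = b.2 ∧ G.Adj a.1 b.1) ∨ (a.1 = b.1 ∧ b.2 = s a.1 a.2)
  symm := ⟨by
    rintro ⟨u, x⟩ ⟨w, y⟩ (⟨h₁, h₂⟩ | ⟨h₁, h₂⟩)
    · exact Or.inl ⟨h₁.symm, h₂.symm⟩
    · dsimp at h₁ h₂
      subst h₁ h₂
      exact Or.inr ⟨rfl, (hs.involutive u x).symm⟩⟩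
  loopless := ⟨by
    rintro ⟨u, x⟩ (⟨-, h⟩ | ⟨-, h⟩)
    · exact G.loopless.irrefl _ h
    · exact hs.apply_ne hg u x h.symm⟩

variable (hs : IsFreeUpTo s g) (hg : 1 ≤ g) (G : SimpleGraph V)

/-- The inclusion of the copy of `G` with index `x`. -/
def copyHom (x : X) : G →g hs.matchedCopies hg G where
  toFun u := (u, x)
  map_rel' h := Or.inl ⟨rfl, h⟩

lemma copyHom_injective (x : X) : Function.Injective (hs.copyHom hg G x) :=
  fun _ _ h => congrArg Prod.fst h

variable {hs hg G}

open Classical in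
/-- The word formed by the labels of the edges between different copies along a walk. -/
noncomputable def label {a b : V × X} : (hs.matchedCopies hg G).Walk a b → List V
  | .nil => []
  | .cons (u := a) (v := b) _ p => if a.2 = b.2 then label p else a.1 :: label p

lemma length_label_le {a b : V × X} (p : (hs.matchedCopies hg G).Walk a b) :
    (label p).length ≤ p.length := by
  induction p with
  | nil => simp [label]
  | cons h p ih =>
    rw [label]
    split_ifs <;> simp <;> omega

lemma foldl_label {a b : V × X} (p : (hs.matchedCopies hg G).Walk a b) :
    (label p).foldl (fun x u => s u x) a.2 = b.2 := by
  induction p with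
  | nil => simp [label]
  | cons h p ih =>
    rw [label]
    split_ifs with h₁
    · rw [h₁, ih]
    · rcases h with h | h
      · exact absurd h.1 h₁
      · rw [List.foldl_cons, ← h.2, ih]

lemma mem_edges_of_label_eq_cons {a b : V × X} (p : (hs.matchedCopies hg G).Walk a b) {u : V}
    {l : List V} (hp : label p = u :: l) : s((u, a.2), (u, s u a.2)) ∈ p.edges := by
  induction p with
  | nil => simp [label] at hp
  | @cons a b c h p ih =>
    rw [label] at hp
    rw [Walk.edges_cons, List.mem_cons]
    split_ifs at hp with h₁
    · exact Or.inr (h₁ ▸ ih hp)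
    · left
      obtain ⟨u, x⟩ := a
      obtain ⟨w, y⟩ := b
      rcases h with h | ⟨h₂, h₃⟩
      · exact absurd h.1 h₁
      · dsimp at h₂ h₃ hp
        simp only [List.cons.injEq] at hp
        rw [← hp.1, ← h₂, h₃]

lemma isChain_label {a b : V × X} (p : (hs.matchedCopies hg G).Walk a b) (hp : p.IsTrail) :
    (label p).IsChain (· ≠ ·) := by
  induction p with
  | nil => simp [label]
  | @cons a b c h p ih =>
    rw [Walk.isTrail_cons] at hp
    rw [label]
    split_ifs with h₁
    · exact ih hp.1
    · rcases hw : label p with - | ⟨w, l⟩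
      · simp
      · refine List.isChain_cons_cons.2 ⟨fun hne => hp.2 ?_, hw ▸ ih hp.1⟩
        have hmem := mem_edges_of_label_eq_cons p hw
        obtain ⟨u, x⟩ := a
        obtain ⟨u', y⟩ := b
        rcases h with h | ⟨h₂, h₃⟩
        · exact absurd h.1 h₁
        · dsimp at h₂ h₃ hne hmem
          subst h₂ h₃ hne
          rwa [hs.involutive u x, Sym2.eq_swap] at hmem

lemma label_eq_nil {a : V × X} (p : (hs.matchedCopies hg G).Walk a a) (hp : p.IsTrail)
    (hl : p.length ≤ g) : label p = [] := by
  by_contra hne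
  exact hs.foldl_ne _ (isChain_label p hp) hne ((length_label_le p).trans hl) _ (foldl_label p)

lemma exists_map_of_label_eq_nil {a b : V × X} (p : (hs.matchedCopies hg G).Walk a b)
    (hp : label p = []) {u : V} {x : X} (ha : a = (u, x)) :
    ∃ (w : V) (q : G.Walk u w) (hb : b = (w, x)),
      q.map (hs.copyHom hg G x) = p.copy ha hb := by
  induction p generalizing u with
  | nil => exact ⟨u, .nil, ha, by subst ha; rfl⟩
  | @cons a b c h p ih =>
    rw [label] at hp
    split_ifs at hp with h₁
    subst ha
    obtain ⟨v, y⟩ := b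
    dsimp at h₁
    subst h₁
    obtain ⟨w, q, rfl, hq⟩ := ih hp rfl
    have hadj : G.Adj u v := by
      rcases h with h | h
      · exact h.2
      · exact absurd h.2.symm (hs.apply_ne hg _ _)
    refine ⟨w, .cons hadj q, rfl, ?_⟩
    exact congrArg (Walk.cons h) (hq.trans (Walk.copy_rfl_rfl p))

lemma exists_map_of_isCycle {u : V} {x : X} (p : (hs.matchedCopies hg G).Walk (u, x) (u, x))
    (hp : p.IsCycle) (hl : p.length ≤ g) :
    ∃ q : G.Walk u u, q.IsCycle ∧ q.map (hs.copyHom hg G x) = p := by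
  obtain ⟨w, q, hb, hq⟩ := exists_map_of_label_eq_nil p
    (label_eq_nil p hp.isCircuit.isTrail hl) rfl
  obtain rfl : u = w := congrArg Prod.fst hb
  refine ⟨q, ?_, hq⟩
  rw [← Walk.isCycle_map_iff_of_injective (hs.copyHom_injective hg G x), hq]
  exact hp

lemma vertexCycleCount_matchedCopies (u : V) (x : X) :
    vertexCycleCount (hs.matchedCopies hg G) g (u, x) = vertexCycleCount G g u := by
  refine (Nat.card_congr (Equiv.ofBijective (fun q => ⟨q.1.map (hs.copyHom hg G x),
    (Walk.isCycle_map_iff_of_injective (hs.copyHom_injective hg G x)).2 q.2.1,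
    (Walk.length_map _ q.1).trans q.2.2⟩) ⟨?_, ?_⟩)).symm
  · intro q r h
    exact Subtype.ext (Walk.map_injective_of_injective
      (hs.copyHom_injective hg G x) _ _ (congrArg Subtype.val h))
  · rintro ⟨p, hp, hl⟩
    obtain ⟨q, hq, rfl⟩ := exists_map_of_isCycle p hp hl.le
    exact ⟨⟨q, hq, (Walk.length_map _ q).symm.trans hl⟩, rfl⟩

lemma card_neighborSet_matchedCopies [Finite V] (u : V) (x : X) :
    Nat.card ((hs.matchedCopies hg G).neighborSet (u, x)) =
      Nat.card (G.neighborSet u) + 1 := by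
  have h : (hs.matchedCopies hg G).neighborSet (u, x) =
      insert (u, s u x) (hs.copyHom hg G x '' G.neighborSet u) := by
    ext ⟨w, y⟩
    simp only [mem_neighborSet, matchedCopies, copyHom, Set.mem_insert_iff,
      Set.mem_image, Prod.mk.injEq]
    constructor
    · rintro (⟨rfl, h⟩ | ⟨rfl, h⟩)
      · exact Or.inr ⟨w, h, rfl⟩
      · exact Or.inl ⟨rfl, h⟩
    · rintro (⟨rfl, rfl⟩ | ⟨w, h, hw⟩)
      · exact Or.inr ⟨rfl, rfl⟩
      · obtain ⟨rfl, rfl⟩ := Prod.mk.inj hw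
        exact Or.inl ⟨rfl, h⟩
  rw [h, Nat.card_coe_set_eq, Set.ncard_insert_of_notMem,
    Set.ncard_image_of_injective _ (hs.copyHom_injective hg G x), Nat.card_coe_set_eq]
  rintro ⟨w, -, hw⟩
  exact hs.apply_ne hg u x (congrArg Prod.snd hw).symm

lemma girth_matchedCopies [Nonempty X] (hG : G.girth = g) :
    (hs.matchedCopies hg G).girth = g := by
  have hcyc : ¬ G.IsAcyclic := fun h => by
    have := girth_eq_zero.2 h
    omega
  obtain ⟨u, q, hq, hl⟩ := exists_girth_eq_length.2 hcyc
  obtain ⟨x⟩ := ‹Nonempty X›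
  have hq' := (Walk.isCycle_map_iff_of_injective (hs.copyHom_injective hg G x)).2 hq
  have hle : (hs.matchedCopies hg G).girth ≤ g :=
    hq'.girth_le_length.trans (by rw [Walk.length_map, ← hl, hG])
  obtain ⟨⟨w, y⟩, p, hp, hpl⟩ :=
    exists_girth_eq_length.2 fun h : (hs.matchedCopies hg G).IsAcyclic => h _ hq'
  obtain ⟨r, hr, hrp⟩ := exists_map_of_isCycle p hp (hpl ▸ hle)
  have hlen : r.length = p.length :=
    (Walk.length_map _ r).symm.trans (congrArg Walk.length hrp)
  exact le_antisymm hle (hG.symm.le.trans (hr.girth_le_length.trans_eq (hlen.trans hpl.symm)))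

lemma isVGR_matchedCopies [Finite X] [Nonempty X] {v k lam : ℕ} (hG : IsVGR G v k g lam) :
    IsVGR (hs.matchedCopies hg G) (v * Nat.card X) (k + 1) g lam := by
  obtain ⟨hfin, hv, hk, hgirth, hcount⟩ := hG
  refine ⟨inferInstance, by rw [Nat.card_prod, hv], fun ⟨u, x⟩ => ?_, ?_, fun ⟨u, x⟩ => ?_⟩
  · rw [card_neighborSet_matchedCopies, hk]
  · exact congrArg _ (girth_matchedCopies (by exact_mod_cast hgirth))
  · rw [vertexCycleCount_matchedCopies, hcount]

end IsFreeUpTo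

lemma IsVGR.pos {V : Type} {G : SimpleGraph V} {v k g lam : ℕ} (hg : 1 ≤ g)
    (hG : IsVGR G v k g lam) : 0 < v := by
  obtain ⟨hfin, hv, -, hgirth, -⟩ := hG
  have hcyc : ¬ G.IsAcyclic := fun h => by
    rw [girth_eq_zero.2 h] at hgirth
    have : 0 = g := by exact_mod_cast hgirth
    omega
  obtain ⟨u, -⟩ := exists_girth_eq_length.2 hcyc
  have : Nonempty V := ⟨u⟩
  exact hv ▸ Nat.card_pos

/-- if a `vgr(v,k,g,λ)`-graph exists (with `k ≥ 2`, `g ≥ 3`,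
`λ ≥ 1`), then there are infinitely many `v'` for which a
`vgr(v', k+1, g, λ)`-graph exists. -/
theorem vgr_degree_increase (v k g lam : ℕ) (hk : 2 ≤ k) (hg : 3 ≤ g)
    (hlam : 1 ≤ lam)
    (h : ∃ (V : Type) (G : SimpleGraph V), IsVGR G v k g lam) :
    {v' : ℕ | ∃ (V : Type) (G : SimpleGraph V), IsVGR G v' (k + 1) g lam}.Infinite := by
  obtain ⟨V, G, hG⟩ := h
  have hg' : 1 ≤ g := by omega
  have : Finite V := hG.1
  have : Finite (ReducedWord V g) := ReducedWord.finite V g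
  refine Set.infinite_of_injective_forall_mem (f := fun n : ℕ =>
    v * Nat.card (Equiv.Perm (ReducedWord V g) × Fin (n + 1))) ?_ fun n =>
      ⟨_, (isFreeUpTo_toggleHeadPerm V (Fin (n + 1)) g).matchedCopies hg' G,
        IsFreeUpTo.isVGR_matchedCopies hG⟩
  intro m n hmn
  have hpos : 0 < Nat.card (Equiv.Perm (ReducedWord V g)) := Nat.card_pos
  simpa [Nat.card_prod, (hG.pos hg').ne', hpos.ne'] using hmn
end

section
/- For all integers k ≥ 4 and g ≥ 3, there exist infinitely many integers v such that a vgr(v, k, g, 2)-graph exists. -/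
open SimpleGraph

namespace Monoid.CoprodI

variable {ι : Type*} {M : ι → Type*} [∀ i, Group (M i)]

/-- The product in the free product of a list of letters. -/
def letterProd (L : List (Σ i, M i)) : CoprodI M := (L.map fun s => of s.2).prod

theorem letterProd_cons (s : Σ i, M i) (L : List (Σ i, M i)) :
    letterProd (s :: L) = of s.2 * letterProd L := by
  simp [letterProd]

variable [∀ i, DecidableEq (M i)]

namespace Word

theorem length_rcons_le {i : ι} (p : Pair M i) :
    (rcons p).toList.length ≤ p.tail.toList.length + 1 := by
  unfold rcons
  split_ifs <;> simp [cons]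

variable [DecidableEq ι]

theorem length_tail_equivPair_le (i : ι) (w : Word M) :
    (equivPair i w).tail.toList.length ≤ w.toList.length := by
  conv_rhs => rw [← (equivPair i).symm_apply_apply w, equivPair_symm]
  unfold rcons
  split_ifs <;> simp [cons]

theorem length_of_smul_le {i : ι} (m : M i) (w : Word M) :
    (of m • w).toList.length ≤ (equivPair i w).tail.toList.length + 1 := by
  rw [of_smul_def]
  exact length_rcons_le _

theorem equivPair_head_eq_one_of_ne {i j : ι} (hij : i ≠ j) {w : Word M}
    (h : (equivPair i w).head ≠ 1) : (equivPair j w).head = 1 := by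
  by_cases hi : fstIdx w = some i
  · rw [equivPair_eq_of_fstIdx_ne (by simpa [hi] using hij)]
  · exact absurd (by rw [equivPair_eq_of_fstIdx_ne hi]) h

/-- The reduced words with at most `N` syllables. -/
abbrev Bounded (M : ι → Type*) [∀ i, Group (M i)] (N : ℕ) : Type _ :=
  {w : Word M // w.toList.length ≤ N}

/-- Left multiplication by elements of `M i` on the reduced words with at most `N` syllables,
where the orbits that leave this set are replaced by fixed points. -/
def boundedAction (N : ℕ) (i : ι) : M i →* Function.End (Bounded M N) where
  toFun m w :=
    if h : (equivPair i w.1).tail.toList.length < N then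
      ⟨of m • w.1, (length_of_smul_le m w.1).trans h⟩ else w
  map_one' := by
    funext w
    change dite _ _ _ = w
    simp
  map_mul' m m' := by
    funext w
    change dite _ _ _ = dite (List.length (Word.toList (Pair.tail (equivPair i
      (Subtype.val (dite _ _ _))))) < N) _ _
    by_cases h : (equivPair i w.1).tail.toList.length < N
    · simp [h, equivPair_smul_same, mul_smul]
    · simp [h]

instance [Finite ι] [∀ i, Finite (M i)] (N : ℕ) : Finite (Bounded M N) :=
  have : Finite {l : List (Σ i, M i) // l.length ≤ N} := (List.finite_length_le _ N).to_subtype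
  Finite.of_injective (fun w => (⟨w.1.toList, w.2⟩ : {l : List (Σ i, M i) // l.length ≤ N}))
    fun _ _ h => Subtype.ext (Word.ext (congrArg Subtype.val h))

end Word

open Word

variable [DecidableEq ι]

/-- The permutation representation of the free product on words with at most `N` syllables. -/
def boundedRep (M : ι → Type*) [∀ i, Group (M i)] [∀ i, DecidableEq (M i)] (N : ℕ) :
    CoprodI M →* Equiv.Perm (Bounded M N) :=
  lift fun i => (boundedAction N i).toHomPerm

theorem boundedRep_of_apply {N : ℕ} {i : ι} (m : M i) (w : Bounded M N)
    (h : w.1.toList.length < N) : (boundedRep M N (of m) w).1 = of m • w.1 := by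
  have h' := (length_tail_equivPair_le i w.1).trans_lt h
  rw [boundedRep, lift_of]
  change Subtype.val (dite _ _ _) = _
  rw [dif_pos h']

theorem boundedRep_letterProd_apply {N : ℕ} (L : List (Σ i, M i)) (hL : L.length ≤ N) :
    (boundedRep M N (letterProd L) ⟨empty, by simp⟩).1 = letterProd L • empty ∧
      (letterProd L • (empty : Word M)).toList.length ≤ L.length := by
  induction L with
  | nil => simp [letterProd]
  | cons s L ih =>
    simp only [List.length_cons] at hL
    obtain ⟨h1, h2⟩ := ih (by omega)
    rw [letterProd_cons, map_mul, Equiv.Perm.mul_apply, mul_smul]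
    refine ⟨by rw [boundedRep_of_apply _ _ (by rw [h1]; omega), h1], ?_⟩
    have h3 := length_of_smul_le s.2 (letterProd L • (empty : Word M))
    have h4 := length_tail_equivPair_le s.1 (letterProd L • (empty : Word M))
    simp only [List.length_cons]
    omega

theorem smul_empty_eq_of_boundedRep_eq_one {N : ℕ} {L : List (Σ i, M i)} (hL : L.length ≤ N)
    (h : boundedRep M N (letterProd L) = 1) : letterProd L • (empty : Word M) = empty := by
  have := (boundedRep_letterProd_apply L hL).1
  rw [h] at this
  simpa using this.symm

/-- Two consecutive letters of a walk without backtracking in the Cayley graph. -/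
def NonBacktracking (s t : Σ i, M i) : Prop := s.1 = t.1 → s = t ∧ s.2 * s.2 ≠ 1

theorem exists_head_smul_empty {g : ℕ} (s : Σ i, M i) (L : List (Σ i, M i))
    (hlen : (s :: L).length ≤ g) (hchain : (s :: L).IsChain NonBacktracking)
    (hne : ∀ t ∈ s :: L, t.2 ≠ 1)
    (hpow : ∀ t ∈ s :: L, t.2 * t.2 ≠ 1 → ∀ j, 0 < j → j < g → t.2 ^ j ≠ 1) :
    ∃ j, 0 < j ∧ j ≤ (s :: L).length ∧ (j = 1 ∨ s.2 * s.2 ≠ 1) ∧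
      (j = (s :: L).length → s :: L = List.replicate j s) ∧
      (equivPair s.1 (letterProd (s :: L) • (empty : Word M))).head = s.2 ^ j := by
  induction L generalizing s with
  | nil =>
    refine ⟨1, one_pos, by simp, Or.inl rfl, by simp, ?_⟩
    rw [letterProd_cons, mul_smul, equivPair_smul_same, equivPair_eq_of_fstIdx_ne] <;>
      simp [letterProd, fstIdx, empty]
  | cons t L ih =>
    rw [List.isChain_cons_cons] at hchain
    simp only [List.length_cons] at hlen
    obtain ⟨j, h0, hj, hj', hrep, hhead⟩ := ih t (by simp; omega) hchain.2
      (fun x hx => hne x (List.mem_cons_of_mem _ hx))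
      (fun x hx => hpow x (List.mem_cons_of_mem _ hx))
    simp only [List.length_cons] at hj hrep
    rw [letterProd_cons, mul_smul, equivPair_smul_same]
    by_cases hst : s.1 = t.1
    · obtain ⟨rfl, hs⟩ := hchain.1 hst
      refine ⟨j + 1, by omega, by simp; omega, Or.inr hs, fun h => ?_, by rw [hhead, pow_succ']⟩
      rw [hrep (by simpa using h), List.replicate_succ]
    · have hne1 : t.2 ^ j ≠ 1 := by
        rcases hj' with rfl | h
        · simpa using hne t (by simp)
        · exact hpow t (by simp) h j h0 (by omega)
      refine ⟨1, one_pos, by simp, Or.inl rfl, by simp, ?_⟩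
      rw [equivPair_head_eq_one_of_ne (Ne.symm hst) (by rwa [hhead])]
      simp

/-- A short non-backtracking product of letters dies in the bounded representation
only if it is the power of a single letter. -/
theorem eq_replicate_of_boundedRep_eq_one {g : ℕ} {L : List (Σ i, M i)} (hnil : L ≠ [])
    (hlen : L.length ≤ g) (hchain : L.IsChain NonBacktracking) (hne : ∀ t ∈ L, t.2 ≠ 1)
    (hpow : ∀ t ∈ L, t.2 * t.2 ≠ 1 → ∀ j, 0 < j → j < g → t.2 ^ j ≠ 1)
    (h : boundedRep M g (letterProd L) = 1) :
    ∃ s, s.2 * s.2 ≠ 1 ∧ L = List.replicate g s := by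
  obtain ⟨s, L, rfl⟩ := List.exists_cons_of_ne_nil hnil
  obtain ⟨j, h0, hj, hj', hrep, hhead⟩ := exists_head_smul_empty s L hlen hchain hne hpow
  rw [smul_empty_eq_of_boundedRep_eq_one hlen h,
    equivPair_eq_of_fstIdx_ne (by simp [fstIdx, empty])] at hhead
  have hs : s.2 * s.2 ≠ 1 := by
    refine hj'.resolve_left ?_
    rintro rfl
    exact hne s (by simp) (by simpa using hhead.symm)
  have hjg : ¬ j < g := fun hlt => hpow s (by simp) hs j h0 hlt hhead.symm
  obtain rfl : j = g := by omega
  exact ⟨s, hs, hrep (by omega)⟩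

end Monoid.CoprodI

/-- A system of generators of `Γ`, indexed by `A` and closed under inversion, such that the only
nontrivial relations of length at most `g` are the `g`-th powers of the generators in `B`. -/
structure GirthGenerators (Γ A : Type*) [Group Γ] (g : ℕ) where
  val : A → Γ
  inv : A → A
  inv_inv : Function.Involutive inv
  val_inv : ∀ a, val (inv a) = (val a)⁻¹
  B : Set A
  inv_ne : ∀ b ∈ B, inv b ≠ b
  pow_eq_one : ∀ b ∈ B, val b ^ g = 1
  three_le : 3 ≤ g
  eq_replicate : ∀ L : List A, L ≠ [] → L.length ≤ g → L.IsChain (fun a b => b ≠ inv a) →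
    (L.map val).prod = 1 → ∃ b ∈ B, L = List.replicate g b

namespace GirthGenerators

variable {Γ A : Type*} [Group Γ] {g : ℕ} (S : GirthGenerators Γ A g)

theorem val_ne_one (a : A) : S.val a ≠ 1 := by
  intro h
  have hg := S.three_le
  obtain ⟨b, -, hb⟩ := S.eq_replicate [a] (by simp) (by simp; omega) (by simp) (by simpa using h)
  have := congrArg List.length hb
  simp at this
  omega

theorem val_injective : Function.Injective S.val := by
  intro a b h
  by_contra hab
  have hg := S.three_le
  obtain ⟨c, -, hc⟩ := S.eq_replicate [a, S.inv b] (by simp) (by simp; omega)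
    (by simpa using fun h' => hab (S.inv_inv.injective h').symm) (by simp [S.val_inv, h])
  have := congrArg List.length hc
  simp at this
  omega

theorem val_pow_ne_one {b : A} (hb : b ∈ S.B) {j : ℕ} (h0 : 0 < j) (hj : j < g) :
    S.val b ^ j ≠ 1 := by
  intro h
  obtain ⟨c, -, hc⟩ := S.eq_replicate (List.replicate j b) (by simp; omega) (by simp; omega)
    (List.isChain_replicate_of_rel _ (S.inv_ne b hb).symm) (by simpa using h)
  have := congrArg List.length hc
  simp at this
  omega

theorem val_pow_injOn {b : A} (hb : b ∈ S.B) {i j : ℕ} (hi : i < g) (hj : j < g)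
    (h : S.val b ^ i = S.val b ^ j) : i = j := by
  wlog hij : i ≤ j generalizing i j
  · exact (this hj hi h.symm (by omega)).symm
  by_contra hne
  refine S.val_pow_ne_one hb (j := j - i) (by omega) (by omega) ?_
  rw [pow_sub _ hij, h, mul_inv_cancel]

/-- The Cayley graph of a system of generators. -/
def cayleyGraph : SimpleGraph Γ where
  Adj u v := ∃ a, v = u * S.val a
  symm := ⟨by
    rintro u v ⟨a, rfl⟩
    exact ⟨S.inv a, by simp [S.val_inv]⟩⟩
  loopless := ⟨by
    rintro u ⟨a, ha⟩
    exact S.val_ne_one a (by simpa using ha)⟩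

theorem card_neighborSet (u : Γ) : Nat.card (S.cayleyGraph.neighborSet u) = Nat.card A := by
  refine (Nat.card_congr (Equiv.ofBijective
    (fun a => (⟨u * S.val a, a, rfl⟩ : S.cayleyGraph.neighborSet u)) ⟨fun a b h => ?_, ?_⟩)).symm
  · exact S.val_injective (mul_left_cancel (congrArg Subtype.val h))
  · rintro ⟨_, a, rfl⟩
    exact ⟨a, rfl⟩

theorem getVert_of_isCycle {u : Γ} {p : S.cayleyGraph.Walk u u} (hp : p.IsCycle)
    (hlen : p.length ≤ g) :
    p.length = g ∧ ∃ b ∈ S.B, ∀ i ≤ g, p.getVert i = u * S.val b ^ i := by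
  have h3 := hp.three_le_length
  have hstep : ∀ i, ∃ a, i < p.length → p.getVert (i + 1) = p.getVert i * S.val a := by
    intro i
    by_cases hi : i < p.length
    · obtain ⟨a, ha⟩ := p.adj_getVert_succ hi
      exact ⟨a, fun _ => ha⟩
    · obtain ⟨a, -⟩ := p.adj_getVert_succ (i := 0) (by omega)
      exact ⟨a, fun h => absurd h hi⟩
  choose l hl using hstep
  have hprod : ∀ n ≤ p.length, p.getVert n = u * (((List.range n).map l).map S.val).prod := by
    intro n
    induction n with
    | zero => simp
    | succ n ih =>
      intro hn
      rw [hl n (by omega), ih (by omega)]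
      simp [List.range_succ, mul_assoc]
  have hchain : ((List.range p.length).map l).IsChain (fun a b => b ≠ S.inv a) := by
    rw [List.isChain_map, List.isChain_range]
    intro m hm h
    have h2 : p.getVert (m + 1 + 1) = p.getVert m := by
      rw [hl (m + 1) (by omega), hl m (by omega), h, S.val_inv, mul_inv_cancel_right]
    exact hp.getVert_sub_one_ne_getVert_add_one (i := m + 1) (by omega) (by simpa using h2.symm)
  obtain ⟨b, hb, hrep⟩ := S.eq_replicate _ (by
    simpa using (by omega : p.length ≠ 0)) (by simpa using hlen) hchain (by
    simpa using (hprod p.length le_rfl).symm)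
  have hg : p.length = g := by simpa using congrArg List.length hrep
  refine ⟨hg, b, hb, fun i hi => ?_⟩
  rw [hprod i (by omega)]
  have : (List.range i).map l = List.replicate i b := by
    rw [List.eq_replicate_iff]
    refine ⟨by simp, fun c hc => List.eq_of_mem_replicate (n := g) ?_⟩
    rw [← hrep]
    simp only [List.mem_map, List.mem_range] at hc ⊢
    obtain ⟨x, hx, rfl⟩ := hc
    exact ⟨x, by omega, rfl⟩
  simp [this]

end GirthGenerators

theorem SimpleGraph.exists_walk_getVert {V : Type*} {G : SimpleGraph V} (n : ℕ) (w : ℕ → V)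
    (hw : ∀ i < n, G.Adj (w i) (w (i + 1))) :
    ∃ p : G.Walk (w 0) (w n), p.length = n ∧ ∀ i ≤ n, p.getVert i = w i := by
  induction n generalizing w with
  | zero => exact ⟨.nil, by simp⟩
  | succ n ih =>
    obtain ⟨p, hp, hp'⟩ := ih (fun i => w (i + 1)) fun i hi => hw (i + 1) (by omega)
    refine ⟨.cons (hw 0 (by omega)) p, by simp [hp], fun i hi => ?_⟩
    cases i with
    | zero => simp
    | succ i => simpa using hp' i (by omega)

namespace GirthGenerators

variable {Γ A : Type*} [Group Γ] {g : ℕ} (S : GirthGenerators Γ A g)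

theorem exists_isCycle (u : Γ) {b : A} (hb : b ∈ S.B) :
    ∃ p : S.cayleyGraph.Walk u u, (p.IsCycle ∧ p.length = g) ∧
      ∀ i ≤ g, p.getVert i = u * S.val b ^ i := by
  obtain ⟨p, hp, hp'⟩ := S.cayleyGraph.exists_walk_getVert g (fun i => u * S.val b ^ i)
    fun i _ => ⟨b, by rw [pow_succ, mul_assoc]⟩
  have h3 := S.three_le
  refine ⟨p.copy (by simp) (by simp [S.pow_eq_one b hb]), ⟨?_, by simpa using hp⟩,
    by simpa using hp'⟩
  rw [SimpleGraph.Walk.isCycle_iff_isPath_tail_and_le_length]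
  refine ⟨?_, by simpa [hp] using h3⟩
  rw [← SimpleGraph.Walk.IsPath.getVert_injOn_iff]
  have htail := SimpleGraph.Walk.length_tail_add_one
    (p := p.copy (show u * S.val b ^ 0 = u by simp) (show u * S.val b ^ g = u by
      simp [S.pow_eq_one b hb])) (by
    rw [← SimpleGraph.Walk.length_eq_zero_iff]
    simp only [SimpleGraph.Walk.length_copy]
    omega)
  simp only [SimpleGraph.Walk.length_copy, hp] at htail
  intro i hi j hj hij
  simp only [Set.mem_ofPred_eq] at hi hj
  rw [SimpleGraph.Walk.getVert_tail, SimpleGraph.Walk.getVert_tail,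
    SimpleGraph.Walk.getVert_copy, SimpleGraph.Walk.getVert_copy, hp' _ (by omega),
    hp' _ (by omega)] at hij
  have := mul_left_cancel hij
  rw [pow_succ, pow_succ] at this
  exact S.val_pow_injOn hb (by omega) (by omega) (mul_right_cancel this)

theorem vertexCycleCount_cayleyGraph (u : Γ) :
    vertexCycleCount S.cayleyGraph g u = Nat.card S.B := by
  have h3 := S.three_le
  choose f hf hf' using fun b : S.B => S.exists_isCycle u b.2
  refine (Nat.card_congr (Equiv.ofBijective
    (fun b => (⟨f b, hf b⟩ : {p : S.cayleyGraph.Walk u u // p.IsCycle ∧ p.length = g}))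
    ⟨fun b c h => ?_, ?_⟩)).symm
  · have h1 := hf' b 1 (by omega)
    rw [show f b = f c from congrArg Subtype.val h, hf' c 1 (by omega)] at h1
    exact Subtype.ext (S.val_injective (by simpa using h1.symm))
  · rintro ⟨p, hp, hlen⟩
    obtain ⟨-, b, hb, hp'⟩ := S.getVert_of_isCycle hp hlen.le
    refine ⟨⟨b, hb⟩, Subtype.ext ?_⟩
    refine SimpleGraph.Walk.ext_getVert_le_length ((hf _).2.trans hlen.symm) fun i hi => ?_
    rw [(hf _).2] at hi
    rw [hf' _ i hi, hp' i hi]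

theorem girth_cayleyGraph (hB : S.B.Nonempty) : S.cayleyGraph.girth = g := by
  obtain ⟨b, hb⟩ := hB
  obtain ⟨p, ⟨hp, hlen⟩, -⟩ := S.exists_isCycle 1 hb
  have hle := SimpleGraph.girth_le_length hp
  obtain ⟨v, q, hq, hq'⟩ := SimpleGraph.exists_girth_eq_length.2
    (fun h : S.cayleyGraph.IsAcyclic => h p hp)
  rw [hq'] at hle ⊢
  exact (S.getVert_of_isCycle hq (by omega)).1

theorem isVGR_cayleyGraph [Finite Γ] {lam : ℕ} (hlam : Nat.card S.B = 2 * lam)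
    (hpos : 0 < lam) : IsVGR S.cayleyGraph (Nat.card Γ) (Nat.card A) g lam := by
  refine ⟨inferInstance, rfl, S.card_neighborSet, ?_, fun u => ?_⟩
  · rw [S.girth_cayleyGraph]
    rw [← Set.nonempty_coe_sort]
    exact (Nat.card_pos_iff.1 (by omega)).1
  · rw [S.vertexCycleCount_cayleyGraph, hlam]

/-- Generators of a product with a group on which they act trivially; the Cayley graph is a
disjoint union of copies. -/
def prod (Δ : Type*) [Group Δ] : GirthGenerators (Γ × Δ) A g where
  val a := (S.val a, 1)
  inv := S.inv
  inv_inv := S.inv_inv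
  val_inv a := by simp [S.val_inv]
  B := S.B
  inv_ne := S.inv_ne
  pow_eq_one b hb := by simp [S.pow_eq_one b hb]
  three_le := S.three_le
  eq_replicate L h1 h2 h3 h4 := S.eq_replicate L h1 h2 h3 (by
    have := congrArg (MonoidHom.fst Γ Δ) h4
    rw [map_list_prod, List.map_map] at this
    exact this)

end GirthGenerators

open Monoid.CoprodI in
/-- Suitable letters of a free product generate its bounded representation
without short relations. -/
def Monoid.CoprodI.girthGenerators {ι A : Type*} {M : ι → Type*} [∀ i, Group (M i)] [DecidableEq ι]
    [∀ i, DecidableEq (M i)] (g : ℕ) (hg : 3 ≤ g) (letter : A → Σ i, M i) (inv : A → A)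
    (hletter : Function.Injective letter) (hinv : Function.Involutive inv)
    (hletter_inv : ∀ a, letter (inv a) = ⟨(letter a).1, (letter a).2⁻¹⟩)
    (hchain : ∀ a b, b ≠ inv a → NonBacktracking (letter a) (letter b))
    (hne : ∀ a, (letter a).2 ≠ 1)
    (hpow : ∀ a, (letter a).2 * (letter a).2 ≠ 1 →
      (letter a).2 ^ g = 1 ∧ ∀ j, 0 < j → j < g → (letter a).2 ^ j ≠ 1) :
    GirthGenerators (Equiv.Perm (Word.Bounded M g)) A g where
  val a := boundedRep M g (of (letter a).2)
  inv := inv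
  inv_inv := hinv
  val_inv a := by rw [hletter_inv, map_inv, map_inv]
  B := {a | (letter a).2 * (letter a).2 ≠ 1}
  inv_ne b hb h := by
    have h' := hletter_inv b
    rw [h] at h'
    exact hb (mul_eq_one_iff_eq_inv.2 (eq_of_heq (Sigma.ext_iff.1 h').2))
  pow_eq_one b hb := by rw [← map_pow, ← map_pow, (hpow b hb).1, map_one, map_one]
  three_le := hg
  eq_replicate L hnil hlen hL hprod := by
    obtain ⟨s, hs, hs'⟩ := eq_replicate_of_boundedRep_eq_one (L := L.map letter) (g := g)
      (by simpa using hnil) (by simpa using hlen) ((List.isChain_map _).2 (hL.imp hchain))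
      (by simpa using fun a _ => hne a)
      (by
        simp only [List.mem_map]
        rintro _ ⟨a, -, rfl⟩ h
        exact (hpow a h).2)
      (by
        rw [letterProd, map_list_prod, List.map_map, List.map_map]
        exact hprod)
    rw [List.eq_replicate_iff, List.length_map] at hs'
    obtain ⟨a, L, rfl⟩ := List.exists_cons_of_ne_nil hnil
    obtain rfl := hs'.2 (letter a) (by simp)
    exact ⟨a, hs, List.eq_replicate_iff.2
      ⟨hs'.1, fun c hc => hletter (hs'.2 _ (List.mem_map_of_mem hc))⟩⟩

open Monoid.CoprodI in
/-- Two generators of order `g` with their inverses, and `m` involutions, without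
further relations of length at most `g`. -/
theorem exists_girthGenerators (g m : ℕ) (hg : 3 ≤ g) :
    ∃ (Γ : Type) (_ : Group Γ) (_ : Finite Γ)
      (S : GirthGenerators Γ ((Fin 2 × Bool) ⊕ Fin m) g), Nat.card S.B = 4 := by
  classical
  have : NeZero g := ⟨by omega⟩
  let M : Fin 2 ⊕ Fin m → Type := fun _ => Multiplicative (ZMod g × ZMod 2)
  have hfin : ∀ i, Finite (M i) := fun _ => inferInstanceAs (Finite (ZMod g × ZMod 2))
  let idx : (Fin 2 × Bool) ⊕ Fin m → Fin 2 ⊕ Fin m := Sum.map Prod.fst id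
  let vec : (Fin 2 × Bool) ⊕ Fin m → ZMod g × ZMod 2 :=
    Sum.elim (fun x => (if x.2 then 1 else -1, 0)) (fun _ => (0, 1))
  let letter : (Fin 2 × Bool) ⊕ Fin m → Σ i, M i := fun a => ⟨idx a, .ofAdd (vec a)⟩
  let inv : (Fin 2 × Bool) ⊕ Fin m → (Fin 2 × Bool) ⊕ Fin m := Sum.map (fun x => (x.1, !x.2)) id
  have hcast : ∀ j, 0 < j → j < g → (j : ZMod g) ≠ 0 := fun j h0 hj h =>
    absurd (Nat.le_of_dvd h0 ((ZMod.natCast_eq_zero_iff j g).1 h)) (by omega)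
  have hvec_inv : ∀ a, vec (inv a) = -vec a := by
    rintro (⟨i, _ | _⟩ | y) <;> simp [vec, inv]
  have hpow_inl : ∀ x j, 0 < j → j < g → j • vec (.inl x) ≠ 0 := by
    rintro ⟨i, _ | _⟩ j h0 hj h <;> simp [vec, hcast j h0 hj] at h
  have hvec : ∀ a, vec a ≠ 0 := by
    rintro (x | y)
    · simpa using hpow_inl x 1 one_pos (by omega)
    · simp [vec]
  have hsq_inl : ∀ x, vec (.inl x) + vec (.inl x) ≠ 0 := fun x => by
    simpa only [two_nsmul] using hpow_inl x 2 two_pos (by omega)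
  have hsq_inr : ∀ y, vec (.inr y) + vec (.inr y) = 0 := fun y => by
    simp only [vec, Sum.elim_inr, Prod.mk_add_mk, add_zero]
    rfl
  have hletter : ∀ {a b}, idx a = idx b → vec a = vec b → a = b := by
    have h1 : (1 : ZMod g) ≠ -1 := fun h => by
      refine hcast 2 two_pos (by omega) ?_
      rw [Nat.cast_two, ← one_add_one_eq_two]
      nth_rewrite 2 [h]
      simp
    rintro (⟨i, _ | _⟩ | y) (⟨i', _ | _⟩ | y') <;> simp [idx, vec, h1, h1.symm]
  have hchain_imp : ∀ a b, b ≠ inv a → NonBacktracking (letter a) (letter b) := by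
    rintro (⟨i, b⟩ | y) (⟨i', b'⟩ | y') h hi <;> simp [letter, idx] at hi <;> subst hi
    · have hb : b' = b := by simpa [inv] using h
      subst hb
      exact ⟨rfl, hsq_inl _⟩
    · exact absurd rfl h
  have hletter_inv : ∀ a, letter (inv a) = ⟨(letter a).1, (letter a).2⁻¹⟩ := by
    rintro (x | y)
    · exact Sigma.ext rfl (heq_of_eq (congrArg Multiplicative.ofAdd (hvec_inv (.inl x))))
    · exact Sigma.ext rfl (heq_of_eq (congrArg Multiplicative.ofAdd (hvec_inv (.inr y))))
  let S := girthGenerators g hg letter inv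
    (fun a b h => hletter (congrArg Sigma.fst h)
      (congrArg (fun s : Σ i, M i => (show ZMod g × ZMod 2 from s.2)) h))
    (by rintro (⟨i, b⟩ | y) <;> simp [inv]) hletter_inv hchain_imp hvec
    (by
      rintro (x | y) h
      · refine ⟨?_, hpow_inl x⟩
        change g • vec (.inl x) = 0
        simp [vec]
      · exact absurd (hsq_inr y) h)
  have hB : S.B = Set.range Sum.inl := by
    ext (x | y)
    · exact iff_of_true (hsq_inl x) ⟨x, rfl⟩
    · exact iff_of_false (fun h => h (hsq_inr y)) (by simp)
  refine ⟨_, inferInstance, inferInstance, S, ?_⟩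
  rw [hB, Nat.card_congr (Equiv.ofInjective _ Sum.inl_injective).symm]
  simp

/-- for all `k ≥ 4` and `g ≥ 3` there are infinitely many `v`
such that a `vgr(v, k, g, 2)`-graph exists. -/
theorem infinitely_many_vgr_lambda_two (k g : ℕ) (hk : 4 ≤ k) (hg : 3 ≤ g) :
    {v : ℕ | ∃ (V : Type) (G : SimpleGraph V), IsVGR G v k g 2}.Infinite := by
  obtain ⟨Γ, _, _, S, hS⟩ := exists_girthGenerators g (k - 4) hg
  refine Set.infinite_of_injective_forall_mem (f := fun n : ℕ => Nat.card Γ * (n + 1)) ?_ ?_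
  · intro a b h
    simpa [Nat.card_pos.ne'] using h
  · intro n
    have h := (S.prod (Multiplicative (ZMod (n + 1)))).isVGR_cayleyGraph (lam := 2) hS two_pos
    have hA : Nat.card ((Fin 2 × Bool) ⊕ Fin (k - 4)) = k := by simp; omega
    have hv : Nat.card (Γ × Multiplicative (ZMod (n + 1))) = Nat.card Γ * (n + 1) := by simp
    rw [hA, hv] at h
    exact ⟨_, _, h⟩
end

section
/- Let G be a vgr(n,k,g,λ)-graph with k ≥ 3 and odd girth g = 2h+1. Then n ≥ (k(k−1)^h − 2)/(k−2) + ⌈(k(k−1)^h − 2λ)/k⌉. -/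
open SimpleGraph

namespace SimpleGraph

variable {V : Type*} {G : SimpleGraph V}

/-- Two paths with the same ends and total length below the girth coincide: otherwise their union
would contain a cycle that is too short. -/
theorem Walk.IsPath.eq_of_length_add_length_lt_girth {u v : V} {p q : G.Walk u v}
    (hp : p.IsPath) (hq : q.IsPath) (hpq : p.length + q.length < G.girth) : p = q := by
  classical
  let H : SimpleGraph V := fromEdgeSet {e | e ∈ p.edges ++ q.edges}
  have hHG : H ≤ G := by
    intro a b hab
    have hab' : s(a, b) ∈ p.edges ++ q.edges := ((fromEdgeSet_adj _).1 hab).1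
    rcases List.mem_append.1 hab' with h | h
    · exact p.adj_of_mem_edges h
    · exact q.adj_of_mem_edges h
  have mem_H : ∀ e ∈ p.edges ++ q.edges, e ∈ H.edgeSet := by
    intro e he
    have heG : e ∈ G.edgeSet := by
      rcases List.mem_append.1 he with h | h
      · exact p.edges_subset_edgeSet h
      · exact q.edges_subset_edgeSet h
    rw [edgeSet_fromEdgeSet]
    exact ⟨he, fun hd => G.not_isDiag_of_mem_edgeSet heG hd⟩
  have hH : H.IsAcyclic := by
    intro a c hc
    have hsub : c.edges ⊆ p.edges ++ q.edges := by
      intro e he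
      have := c.edges_subset_edgeSet he
      rw [edgeSet_fromEdgeSet] at this
      exact this.1
    have hlen := (hc.edges_nodup.subperm hsub).length_le
    have hgirth := girth_le_length (hc.mapLe hHG)
    simp at hlen hgirth
    omega
  have hpH : ∀ e ∈ p.edges, e ∈ H.edgeSet := fun e he => mem_H e (List.mem_append_left _ he)
  have hqH : ∀ e ∈ q.edges, e ∈ H.edgeSet := fun e he => mem_H e (List.mem_append_right _ he)
  have heq := congrArg Subtype.val
    ((hH.subsingleton_path u v).elim
    ⟨p.transfer H hpH, hp.transfer hpH⟩ ⟨q.transfer H hqH, hq.transfer hqH⟩)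
  have hsupp := congrArg Walk.support heq
  simp only [Walk.support_transfer] at hsupp
  exact Walk.ext_support hsupp

theorem Walk.IsPath.cons_of_length_lt_girth {u v w : V} {p : G.Walk v u} (hp : p.IsPath)
    (h : G.Adj w v) (hw : w ≠ p.snd) (hlen : p.length + 1 < G.girth) :
    (Walk.cons h p).IsPath := by
  classical
  rw [Walk.cons_isPath_iff]
  refine ⟨hp, fun hmem => hw ?_⟩
  have hle := p.length_takeUntil_le_length hmem
  have hedge : (Walk.cons h.symm Walk.nil : G.Walk v w).IsPath := by
    simp [h.ne']
  have heq := (hp.takeUntil hmem).eq_of_length_add_length_lt_girth hedge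
    (by simp only [Walk.length_cons, Walk.length_nil]; omega)
  rw [← p.take_spec hmem, heq]
  simp

/-- Two paths with the same ends, of different lengths summing to the girth, form a cycle. -/
theorem Walk.IsPath.isCycle_reverse_append {u v : V} {p q : G.Walk v u} (hp : p.IsPath)
    (hq : q.IsPath) (hpq : p.length + q.length = G.girth) (hodd : Odd G.girth)
    (h3 : 3 ≤ G.girth) : (q.reverse.append p).IsCycle := by
  classical
  have hlen : (q.reverse.append p).length = G.girth := by simp; omega
  rw [Walk.isCycle_iff_isPath_tail_and_le_length]
  refine ⟨?_, by omega⟩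
  rw [Walk.isPath_def, Walk.support_tail_of_not_nil _ (by
    intro hn
    have := hn.length_eq_zero
    omega), Walk.tail_support_append]
  have hr := hq.reverse
  refine List.nodup_append'.2 ⟨hr.support_nodup.tail, hp.support_nodup.tail, ?_⟩
  intro z hzq hzp
  have hzu : z ≠ u := by
    rintro rfl
    have := hr.support_nodup
    rw [← Walk.cons_tail_support] at this
    exact (List.nodup_cons.1 this).1 hzq
  have hzv : z ≠ v := by
    rintro rfl
    have := hp.support_nodup
    rw [← Walk.cons_tail_support] at this
    exact (List.nodup_cons.1 this).1 hzp
  have hp' : z ∈ p.support := List.mem_of_mem_tail hzp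
  have hq' : z ∈ q.support := by simpa using List.mem_of_mem_tail hzq
  have h1 := congrArg Walk.length (p.take_spec hp')
  have h2 := congrArg Walk.length (q.take_spec hq')
  rw [Walk.length_append] at h1 h2
  have h4 : (p.takeUntil z hp').length ≠ 0 := fun h => hzv (Walk.eq_of_length_eq_zero h).symm
  have h5 : (p.dropUntil z hp').length ≠ 0 := fun h => hzu (Walk.eq_of_length_eq_zero h)
  have e1 := congrArg Walk.length ((hp.takeUntil hp').eq_of_length_add_length_lt_girth
    (hq.takeUntil hq') (by omega))
  have e2 := congrArg Walk.length ((hp.dropUntil hp').eq_of_length_add_length_lt_girth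
    (hq.dropUntil hq') (by omega))
  obtain ⟨m, hm⟩ := hodd
  omega

variable (G) in
/-- The paths of length `i` ending at `u`, bundled with their starting vertex. -/
abbrev PathsTo (u : V) (i : ℕ) : Type _ :=
  {p : Σ v, G.Walk v u // p.2.IsPath ∧ p.2.length = i}

theorem PathsTo.eq_nil {u : V} (p : G.PathsTo u 0) :
    p = ⟨⟨u, Walk.nil⟩, Walk.IsPath.nil, rfl⟩ := by
  obtain ⟨⟨v, p⟩, hp, hpi⟩ := p
  cases p with
  | nil => rfl
  | cons hvx p => simp at hpi

theorem PathsTo.ext_of_fst_eq {u : V} {i j : ℕ} (p : G.PathsTo u i) (q : G.PathsTo u j)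
    (hij : i + j < G.girth) (h : p.1.1 = q.1.1) : p.1 = q.1 := by
  obtain ⟨⟨v, p⟩, hp, hpi⟩ := p
  obtain ⟨⟨w, q⟩, hq, hqj⟩ := q
  obtain rfl : v = w := h
  exact congrArg (Sigma.mk v) <| hp.eq_of_length_add_length_lt_girth hq (by dsimp only at *; omega)

theorem PathsTo.ext_of_snd_eq {u : V} {i : ℕ} (p q : G.PathsTo u (i + 1))
    (hi : i + i < G.girth) (h : p.1.1 = q.1.1) (hsnd : p.1.2.snd = q.1.2.snd) : p = q := by
  obtain ⟨⟨v, p⟩, hp, hpi⟩ := p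
  obtain ⟨⟨w, q⟩, hq, hqi⟩ := q
  obtain rfl : v = w := h
  cases p with
  | nil => simp at hpi
  | cons hvx p =>
    cases q with
    | nil => simp at hqi
    | cons hvy q =>
      simp only [Walk.snd_cons] at hsnd
      subst hsnd
      simp only [Walk.length_cons] at hpi hqi
      have : p = q :=
        hp.of_cons.eq_of_length_add_length_lt_girth hq.of_cons (by omega)
      subst this
      rfl

theorem PathsTo.finite [Finite V] {u : V} {i : ℕ} (hi : i + i < G.girth + 2) :
    Finite (G.PathsTo u i) := by
  cases i with
  | zero => exact @Finite.of_subsingleton _ ⟨fun p q => p.eq_nil.trans q.eq_nil.symm⟩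
  | succ i =>
    refine Finite.of_injective (fun p : G.PathsTo u (i + 1) => (p.1.1, p.1.2.snd)) fun p q h => ?_
    exact ext_of_snd_eq p q (by omega) (congrArg Prod.fst h) (congrArg Prod.snd h)

theorem PathsTo.card_mul_le_card_succ [Finite V] {u : V} {i m : ℕ} (hi : i + 1 < G.girth)
    (hi' : i + i < G.girth)
    (hm : ∀ p : G.PathsTo u i, m ≤ Nat.card {w // G.Adj w p.1.1 ∧ w ≠ p.1.2.snd}) :
    Nat.card (G.PathsTo u i) * m ≤ Nat.card (G.PathsTo u (i + 1)) := by
  classical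
  have := PathsTo.finite (G := G) (u := u) (i := i) (by omega)
  have := PathsTo.finite (G := G) (u := u) (i := i + 1) (by omega)
  have := Fintype.ofFinite (G.PathsTo u i)
  calc Nat.card (G.PathsTo u i) * m
      = ∑ _p : G.PathsTo u i, m := by simp
    _ ≤ ∑ p : G.PathsTo u i, Nat.card {w // G.Adj w p.1.1 ∧ w ≠ p.1.2.snd} :=
        Finset.sum_le_sum fun p _ => hm p
    _ = Nat.card (Σ p : G.PathsTo u i, {w // G.Adj w p.1.1 ∧ w ≠ p.1.2.snd}) :=
        Nat.card_sigma.symm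
    _ ≤ Nat.card (G.PathsTo u (i + 1)) := by
        refine Nat.card_le_card_of_injective
          (fun x => ⟨⟨x.2.1, Walk.cons x.2.2.1 x.1.1.2⟩,
            x.1.2.1.cons_of_length_lt_girth x.2.2.1 x.2.2.2 (by rw [x.1.2.2]; exact hi),
            by simp [x.1.2.2]⟩) ?_
        rintro ⟨⟨⟨v, p⟩, hp⟩, ⟨w, hw⟩⟩ ⟨⟨⟨v', p'⟩, hp'⟩, ⟨w', hw'⟩⟩ h
        simp only [Subtype.mk.injEq, Sigma.mk.injEq] at h
        obtain ⟨rfl, h⟩ := h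
        have h := eq_of_heq h
        simp only [Walk.cons.injEq] at h
        obtain ⟨rfl, h⟩ := h
        obtain rfl := eq_of_heq h
        rfl

theorem le_card_neighbors_ne [Finite V] {k : ℕ} {v : V} (hk : Nat.card (G.neighborSet v) = k)
    (x : V) : k - 1 ≤ Nat.card {w // G.Adj w v ∧ w ≠ x} := by
  have h : {w | G.Adj w v ∧ w ≠ x} = G.neighborSet v \ {x} := by
    ext w; simp [G.adj_comm]
  have := Set.pred_ncard_le_ncard_sdiff_singleton (G.neighborSet v) x
  rw [← h] at this
  rw [← hk]
  exact this

theorem card_pathsTo_zero (u : V) : Nat.card (G.PathsTo u 0) = 1 := by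
  exact Nat.card_eq_one_iff_exists.2 ⟨_, PathsTo.eq_nil⟩

theorem le_card_pathsTo [Finite V] {k : ℕ} (hk : ∀ v, Nat.card (G.neighborSet v) = k) (u : V)
    {h : ℕ} (hh : 1 ≤ h) (hg : G.girth = 2 * h + 1) :
    ∀ i ≤ h, k * (k - 1) ^ i ≤ Nat.card (G.PathsTo u (i + 1)) := by
  intro i
  induction i with
  | zero =>
    intro _
    have := PathsTo.card_mul_le_card_succ (G := G) (u := u) (i := 0) (m := k)
      (by omega) (by omega) ?_
    · simpa [card_pathsTo_zero] using this
    · intro p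
      rw [p.eq_nil, ← hk u]
      refine Nat.card_le_card_of_injective
        (fun w => ⟨w.1, w.2.symm, fun h => G.ne_of_adj w.2 h.symm⟩) fun a b hab => ?_
      exact Subtype.ext (congrArg (fun z => z.1) hab)
  | succ i ih =>
    intro hi
    calc k * (k - 1) ^ (i + 1) = k * (k - 1) ^ i * (k - 1) := by ring
      _ ≤ Nat.card (G.PathsTo u (i + 1)) * (k - 1) := Nat.mul_le_mul_right _ (ih (by omega))
      _ ≤ _ := PathsTo.card_mul_le_card_succ (by omega) (by omega)
          fun p => le_card_neighbors_ne (hk _) _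

/-- The set of vertices joined to `u` by a path of length at most `h`. -/
def pathBall (G : SimpleGraph V) (u : V) (h : ℕ) : Set V :=
  Set.range fun x : Σ i : Fin (h + 1), G.PathsTo u i => x.2.1.1

theorem ncard_pathBall [Finite V] (u : V) {h : ℕ} (hg : G.girth = 2 * h + 1) :
    (G.pathBall u h).ncard = ∑ i ∈ Finset.range (h + 1), Nat.card (G.PathsTo u i) := by
  have (i : Fin (h + 1)) : Finite (G.PathsTo u i) := PathsTo.finite (by omega)
  rw [Finset.sum_range, ← Nat.card_sigma, pathBall, ← Nat.card_coe_set_eq]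
  refine Nat.card_range_of_injective ?_
  rintro ⟨i, p⟩ ⟨j, q⟩ hpq
  have heq := p.ext_of_fst_eq q (by omega) hpq
  have hij : i = j := by
    apply Fin.ext
    rw [← p.2.2, ← q.2.2, heq]
  subst hij
  rw [Subtype.ext heq]

theorem card_pathsTo_outside_le [Finite V] {k : ℕ} (hk : ∀ v, Nat.card (G.neighborSet v) = k)
    (u : V) {h : ℕ} (hg : G.girth = 2 * h + 1) (s : Set V) :
    Nat.card {p : G.PathsTo u (h + 1) // p.1.1 ∈ s} ≤ s.ncard * k := by
  classical
  have := Fintype.ofFinite s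
  have hcard : s.ncard * k = Nat.card (Σ y : s, G.neighborSet y.1) := by
    rw [Nat.card_sigma]
    simp only [hk, Finset.sum_const, smul_eq_mul, Finset.card_univ]
    rw [← Nat.card_eq_fintype_card, Nat.card_coe_set_eq]
  rw [hcard]
  refine Nat.card_le_card_of_injective
    (fun p => ⟨⟨p.1.1.1, p.2⟩, p.1.1.2.snd, Walk.adj_snd fun hn => by
      have := hn.length_eq_zero
      have := p.1.2.2
      omega⟩) ?_
  rintro ⟨p, hp⟩ ⟨q, hq⟩ hpq
  have h1 := congrArg (fun x : (Σ y : s, G.neighborSet y.1) => x.1.1) hpq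
  have h2 := congrArg (fun x : (Σ y : s, G.neighborSet y.1) => x.2.1) hpq
  exact Subtype.ext (p.ext_of_snd_eq q (by omega) h1 h2)

theorem card_pathsTo_ball_le_vertexCycleCount [Finite V] (u : V) {h : ℕ} (hh : 1 ≤ h)
    (hg : G.girth = 2 * h + 1) :
    Nat.card {p : G.PathsTo u (h + 1) // p.1.1 ∈ G.pathBall u h} ≤
      vertexCycleCount G (2 * h + 1) u := by
  classical
  have := Fintype.ofFinite V
  have hex (p : {p : G.PathsTo u (h + 1) // p.1.1 ∈ G.pathBall u h}) :
      ∃ q : G.Walk p.1.1.1 u, q.IsPath ∧ q.length = h := by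
    obtain ⟨p, ⟨i, q⟩, hq⟩ := p
    dsimp only at hq ⊢
    have hi : i.1 = h := by
      by_contra hne
      have heq := p.ext_of_fst_eq q (by omega) hq.symm
      have h1 := p.2.2
      rw [heq, q.2.2] at h1
      omega
    rw [← hq]
    exact ⟨q.1.2, q.2.1, q.2.2.trans hi⟩
  choose q hq hql using hex
  have : Finite {c : G.Walk u u // c.IsCycle ∧ c.length = 2 * h + 1} :=
    Finite.of_injective
      (β := {c : G.Walk u u // c.length = 2 * h + 1}) (fun c => ⟨c.1, c.2.2⟩)
      fun a b hab => Subtype.ext (congrArg (fun z => z.1) hab)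
  refine Nat.card_le_card_of_injective
    (fun p => ⟨(q p).reverse.append p.1.1.2,
      p.1.2.1.isCycle_reverse_append (hq p)
        (by rw [p.1.2.2, hql, hg]; omega) ⟨h, hg⟩ (by omega),
      by rw [Walk.length_append, Walk.length_reverse, hql, p.1.2.2]; omega⟩) ?_
  intro a b hab
  have hab : (q a).reverse.append a.1.1.2 = (q b).reverse.append b.1.1.2 :=
    congrArg Subtype.val hab
  have hfst := congrArg (Walk.getVert · h) hab
  have hsnd := congrArg (Walk.getVert · (h + 1)) hab
  simp only [Walk.getVert_append, Walk.length_reverse, hql, lt_irrefl, if_false, Nat.sub_self,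
    Walk.getVert_zero, Nat.not_succ_lt_self, Nat.add_sub_cancel_left] at hfst hsnd
  exact Subtype.ext (a.1.ext_of_snd_eq b.1 (by omega) hfst hsnd)

end SimpleGraph

/-- lower bound on the order of a `vgr(n,k,g,λ)`-graph of odd
girth `g = 2h+1`:
`n ≥ (k(k-1)^h - 2)/(k-2) + ⌈(k(k-1)^h - 2λ)/k⌉`. -/
theorem vgr_odd_girth_order_lower_bound {V : Type*} (G : SimpleGraph V)
    (n k g lam h : ℕ) (hk : 3 ≤ k) (hgh : g = 2 * h + 1) (hG : IsVGR G n k g lam) :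
    (n : ℚ) ≥ ((k : ℚ) * ((k : ℚ) - 1) ^ h - 2) / ((k : ℚ) - 2) +
      ((⌈((k : ℚ) * ((k : ℚ) - 1) ^ h - 2 * (lam : ℚ)) / (k : ℚ)⌉ : ℤ) : ℚ) := by
  obtain ⟨hfin, hn, hreg, hgirth, hcyc⟩ := hG
  have hg : G.girth = 2 * h + 1 := by rw [← hgh]; exact_mod_cast hgirth
  have hacyc : ¬ G.IsAcyclic := fun ha => by
    have := girth_eq_zero.2 ha
    omega
  have hh : 1 ≤ h := by
    have := three_le_girth hacyc
    omega
  obtain ⟨u, -, -, -⟩ := exists_girth_eq_length.2 hacyc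
  have hsplit := Set.ncard_add_ncard_compl (G.pathBall u h)
  set o := (G.pathBall u h)ᶜ.ncard with ho
  have hball : 1 + ∑ i ∈ Finset.range h, k * (k - 1) ^ i ≤ (G.pathBall u h).ncard := by
    rw [ncard_pathBall u hg, Finset.sum_range_succ', card_pathsTo_zero, add_comm 1]
    gcongr with i hi
    exact le_card_pathsTo hreg u hh hg i (Finset.mem_range.1 hi).le
  have hout : k * (k - 1) ^ h ≤ 2 * lam + o * k := by
    have : Finite (G.PathsTo u (h + 1)) := PathsTo.finite (by omega)
    have h1 := card_pathsTo_ball_le_vertexCycleCount u hh hg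
    rw [← hgh, hcyc u] at h1
    have h2 := card_pathsTo_outside_le hreg u hg (G.pathBall u h)ᶜ
    have h3 := le_card_pathsTo hreg u hh hg h le_rfl
    classical
    rw [← Nat.card_congr (Equiv.sumCompl fun p : G.PathsTo u (h + 1) => p.1.1 ∈ G.pathBall u h),
      Nat.card_sum] at h3
    exact h3.trans (add_le_add h1 h2)
  have hk3 : (3 : ℚ) ≤ k := by exact_mod_cast hk
  have hcast : ((k - 1 : ℕ) : ℚ) = (k : ℚ) - 1 := by
    rw [Nat.cast_sub (by omega), Nat.cast_one]
  have hgeom : ((k : ℚ) * ((k : ℚ) - 1) ^ h - 2) / ((k : ℚ) - 2) =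
      ((1 + ∑ i ∈ Finset.range h, k * (k - 1) ^ i : ℕ) : ℚ) := by
    have hne : (k : ℚ) - 2 ≠ 0 := by linarith
    push_cast
    rw [hcast, ← Finset.mul_sum, div_eq_iff hne]
    have := geom_sum_mul ((k : ℚ) - 1) h
    linear_combination -(k : ℚ) * this
  have hceil : ⌈((k : ℚ) * ((k : ℚ) - 1) ^ h - 2 * (lam : ℚ)) / (k : ℚ)⌉ ≤ (o : ℤ) := by
    rw [Int.ceil_le, div_le_iff₀ (by linarith), ← hcast]
    have : (k : ℚ) * ((k - 1 : ℕ) : ℚ) ^ h ≤ 2 * lam + o * k := by exact_mod_cast hout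
    push_cast
    linarith
  rw [hgeom, ge_iff_le, ← hn, ← hsplit]
  push_cast [← ho]
  refine add_le_add (by exact_mod_cast hball) (by exact_mod_cast hceil)
end

section
/- Let G be a vgr(n,k,g,λ)-graph with k ≥ 3 and even girth g = 2h, and suppose G has an edge that is contained in exactly Λ distinct girth-cycles. Then n ≥ 2·((k−1)^h − 1)/(k−2) + ⌈((k−1)^h − Λ)² / (2λ − 3Λ + (k−1)^h − 2·max(0, ⌈Λ²/(2(k−1)^(h−1)) − Λ/2⌉))⌉. -/
open SimpleGraph

/-- The number of closed walks based at `u` of length `g` that are cycles and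
traverse the edge `s(u, w)`. Each cycle of length `g ≥ 3` containing the edge
`uw` corresponds to exactly two such walks, so this equals twice the number of
cycles of length `g` containing the edge `uw`. -/
noncomputable def edgeCycleCount {V : Type*} (G : SimpleGraph V) (g : ℕ) (u w : V) : ℕ :=
  Nat.card {p : G.Walk u u // p.IsCycle ∧ p.length = g ∧ s(u, w) ∈ p.edges}

/-- A walk is nonbacktracking if it never traverses the same edge twice in a row. -/
def IsNonbacktracking {V : Type*} {G : SimpleGraph V} {u v : V} (p : G.Walk u v) : Prop :=
  p.edges.IsChain (· ≠ ·)

namespace IsNonbacktracking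

variable {V : Type*} {G : SimpleGraph V} {u v x y : V}

theorem of_isPath {p : G.Walk u v} (hp : p.IsPath) : IsNonbacktracking p :=
  List.Pairwise.isChain hp.isTrail.edges_nodup

theorem append_cons {p : G.Walk u v} {h : G.Adj v x} {q : G.Walk x y}
    (hp : IsNonbacktracking p) (hq : IsNonbacktracking (Walk.cons h q))
    (hx : s(v, x) ∉ p.edges) : IsNonbacktracking (p.append (Walk.cons h q)) := by
  unfold IsNonbacktracking at *
  rw [Walk.edges_append, List.isChain_append]
  refine ⟨hp, hq, fun e he f hf hef => hx ?_⟩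
  simp only [Walk.edges_cons, List.head?_cons, Option.mem_def, Option.some.injEq] at hf
  subst hf hef
  exact List.mem_of_getLast? he

theorem isPath_of_length_lt_girth {p : G.Walk u v} (hp : IsNonbacktracking p)
    (hlen : p.length < G.girth) : p.IsPath := by
  classical
  induction p with
  | nil => simp
  | @cons a b c h p ih =>
    unfold IsNonbacktracking at hp ih
    rw [Walk.edges_cons, List.isChain_cons] at hp
    rw [Walk.length_cons] at hlen
    have hpath : p.IsPath := ih hp.2 (by omega)
    rw [Walk.cons_isPath_iff]
    refine ⟨hpath, fun ha => ?_⟩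
    have hcyc : (Walk.cons h (p.takeUntil a ha)).IsCycle := by
      rw [Walk.cons_isCycle_iff]
      refine ⟨hpath.takeUntil ha, fun he => ?_⟩
      have he' := Walk.edges_takeUntil_subset_edges p ha he
      cases p with
      | nil => simp at he'
      | cons h' q =>
        have := hpath.eq_snd_of_mem_edges (Sym2.eq_swap ▸ he')
        simp only [Walk.snd_cons] at this
        subst this
        exact hp.1 s(b, a) (by simp) Sym2.eq_swap
    have h1 := girth_le_length hcyc
    have h2 := p.length_takeUntil_le_length ha
    rw [Walk.length_cons] at h1
    omega

theorem isCycle_of_length_eq_girth {p : G.Walk u u} (hp : IsNonbacktracking p)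
    (hlen : p.length = G.girth) (h3 : 3 ≤ p.length) : p.IsCycle := by
  cases p with
  | nil => simp at h3
  | cons h p =>
    unfold IsNonbacktracking at hp
    rw [Walk.edges_cons, List.isChain_cons] at hp
    rw [Walk.length_cons] at hlen h3
    have hpath := isPath_of_length_lt_girth (p := p) hp.2 (by omega)
    rw [Walk.cons_isCycle_iff]
    refine ⟨hpath, fun he => ?_⟩
    have := hpath.length_eq_one_of_mem_edges (Sym2.eq_swap ▸ he)
    omega

end IsNonbacktracking

namespace SimpleGraph.Walk

variable {V : Type*} {G : SimpleGraph V} {u v w : V}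

theorem IsPath.eq_of_length_add_length_lt_girth_s11 {p q : G.Walk u v} (hp : p.IsPath)
    (hq : q.IsPath) (hlen : p.length + q.length < G.girth) : p = q := by
  induction p with
  | nil => exact (Walk.eq_nil_iff_nil.2 (isPath_iff_nil.1 hq)).symm
  | @cons a b c h p ih =>
    cases q with
    | nil => simp at hp
    | @cons _ b' _ h' q =>
      simp only [length_cons] at hlen
      obtain rfl | hb := eq_or_ne b b'
      · rw [ih hp.of_cons hq.of_cons (by omega)]
      · have hnb : IsNonbacktracking ((cons h p).reverse.append (cons h' q)) := by
          refine (IsNonbacktracking.of_isPath hp.reverse).append_cons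
            (IsNonbacktracking.of_isPath hq) fun he => hb ?_
          rw [edges_reverse, List.mem_reverse] at he
          simpa using (hp.eq_snd_of_mem_edges he).symm
        have := hnb.isPath_of_length_lt_girth (by simp; omega)
        rw [isPath_iff_nil, ← length_eq_zero_iff] at this
        simp at this

theorem IsPath.notMem_support_of_ne_penultimate {p : G.Walk u v} (hp : p.IsPath)
    (h : G.Adj v w) (hw : w ≠ p.penultimate) (hlen : p.length + 1 < G.girth) :
    w ∉ p.support := by
  classical
  intro hmem
  have hcyc : (cons h (p.dropUntil w hmem)).IsCycle := by
    rw [cons_isCycle_iff]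
    exact ⟨hp.dropUntil hmem, fun he =>
      hw (hp.eq_penultimate_of_mem_edges (p.edges_dropUntil_subset_edges hmem he))⟩
  have h1 := girth_le_length hcyc
  have h2 := p.length_dropUntil_le_length hmem
  rw [length_cons] at h1
  omega

/-- Splitting a walk at its `i`-th edge. -/
theorem exists_eq_append_cons (p : G.Walk u v) {i : ℕ} (hi : i < p.length) :
    ∃ (x y : V) (q : G.Walk u x) (h : G.Adj x y) (r : G.Walk y v),
      p = q.append (cons h r) ∧ q.length = i := by
  induction i generalizing u with
  | zero =>
    cases p with
    | nil => simp at hi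
    | cons h p => exact ⟨_, _, nil, h, p, rfl, rfl⟩
  | succ i ih =>
    cases p with
    | nil => simp at hi
    | cons h p =>
      obtain ⟨x, y, q, h', r, rfl, hq⟩ := ih p (by simpa using hi)
      exact ⟨x, y, cons h q, h', r, rfl, by simp [hq]⟩

end SimpleGraph.Walk

/-- The vertices reached from `u` by a path of length `i` that avoids `w`. -/
def levelSet {V : Type*} (G : SimpleGraph V) (u w : V) (i : ℕ) : Set V :=
  {v | ∃ p : G.Walk u v, p.IsPath ∧ w ∉ p.support ∧ p.length = i}

section levelSet

variable {V : Type*} {G : SimpleGraph V} {u w v : V} {i j : ℕ}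

theorem levelSet_zero (huw : u ≠ w) : levelSet G u w 0 = {u} := by
  ext v
  constructor
  · rintro ⟨p, -, -, hp⟩
    exact (Walk.eq_of_length_eq_zero hp).symm
  · rintro rfl
    exact ⟨Walk.nil, by simp, by simpa using huw.symm, rfl⟩

theorem notMem_levelSet : w ∉ levelSet G u w i := by
  rintro ⟨p, -, hp, -⟩
  exact hp p.end_mem_support

theorem exists_mem_levelSet_of_mem_support {p : G.Walk u v} (hp : p.IsPath)
    (hw : w ∉ p.support) {x : V} (hx : x ∈ p.support) :
    ∃ j ≤ p.length, x ∈ levelSet G u w j := by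
  classical
  exact ⟨_, p.length_takeUntil_le_length hx, p.takeUntil x hx, hp.takeUntil hx,
    fun h => hw (p.support_takeUntil_subset_support hx h), rfl⟩

theorem eq_of_mem_levelSet (hi : v ∈ levelSet G u w i) (hj : v ∈ levelSet G u w j)
    (hij : i + j < G.girth) : i = j := by
  obtain ⟨p, hp, -, rfl⟩ := hi
  obtain ⟨q, hq, -, rfl⟩ := hj
  rw [hp.eq_of_length_add_length_lt_girth_s11 hq hij]

theorem notMem_levelSet_swap (huw : G.Adj u w) (hi : v ∈ levelSet G u w i)
    (hij : i + j + 1 < G.girth) : v ∉ levelSet G w u j := by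
  rintro ⟨q, hq, hu, rfl⟩
  obtain ⟨p, hp, hw, rfl⟩ := hi
  have := hp.eq_of_length_add_length_lt_girth_s11
    (q := Walk.cons huw q) ((Walk.cons_isPath_iff _ _).2 ⟨hq, hu⟩) (by simp; omega)
  exact hw (this ▸ by simp)

theorem penultimate_mem_levelSet {p : G.Walk u v} (hp : p.IsPath) (hw : w ∉ p.support)
    (hnil : ¬p.Nil) : p.penultimate ∈ levelSet G u w (p.length - 1) := by
  rw [← Walk.concat_dropLast (p.adj_penultimate hnil), Walk.concat_eq_append] at hp
  exact ⟨p.dropLast, hp.of_append_left,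
    fun h => hw (by rw [← Walk.support_dropLast_concat hnil]; simp [h]), by simp⟩

theorem exists_adj_mem_levelSet (hv : v ∈ levelSet G u w (i + 1)) :
    ∃ x ∈ levelSet G u w i, G.Adj x v := by
  obtain ⟨p, hp, hw, hl⟩ := hv
  have hnil : ¬p.Nil := by
    rw [← Walk.length_eq_zero_iff]; omega
  have := penultimate_mem_levelSet hp hw hnil
  rw [hl, Nat.add_sub_cancel] at this
  exact ⟨p.penultimate, this, p.adj_penultimate hnil⟩

/-- The neighbours of a vertex in level `i`, except for its parent, form its neighbours in
level `i + 1`. -/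
theorem exists_forall_mem_levelSet_succ_iff (huw : G.Adj u w) (hv : v ∈ levelSet G u w i)
    (h1 : i + 2 < G.girth) (h2 : 2 * i < G.girth) :
    ∃ x, G.Adj v x ∧ ∀ y, G.Adj v y → (y ∈ levelSet G u w (i + 1) ↔ y ≠ x) := by
  obtain ⟨p, hp, hw, rfl⟩ := hv
  have hpath : (Walk.cons huw.symm p).IsPath := (Walk.cons_isPath_iff _ _).2 ⟨hp, hw⟩
  refine ⟨(Walk.cons huw.symm p).penultimate,
    ((Walk.cons huw.symm p).adj_penultimate Walk.not_nil_cons).symm, fun y hy => ⟨?_, fun hne => ?_⟩⟩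
  · rintro hmem rfl
    by_cases hnil : p.Nil
    · cases hnil
      exact notMem_levelSet hmem
    · rw [Walk.penultimate_cons_of_not_nil _ _ hnil] at hmem
      have hpos : p.length ≠ 0 := fun h => hnil (Walk.length_eq_zero_iff.1 h)
      have := eq_of_mem_levelSet (penultimate_mem_levelSet hp hw hnil) hmem (by omega)
      omega
  · have := hpath.notMem_support_of_ne_penultimate hy hne (by simpa using h1)
    rw [Walk.support_cons, List.mem_cons, not_or] at this
    refine ⟨p.concat hy, hp.concat this.2 hy, ?_, by simp⟩
    rw [Walk.support_concat]
    simp [hw, Ne.symm this.1]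

theorem concat_isPath_of_levelSet {x : V} {p : G.Walk u x} (hp : p.IsPath) (hw : w ∉ p.support)
    (hv : v ∈ levelSet G u w (p.length + 1)) (hxv : G.Adj x v) (hlen : 2 * p.length + 1 < G.girth) :
    (p.concat hxv).IsPath := by
  refine hp.concat (fun hmem => ?_) hxv
  obtain ⟨j, hj, hvj⟩ := exists_mem_levelSet_of_mem_support hp hw hmem
  have := eq_of_mem_levelSet hv hvj (by omega)
  omega

theorem eq_of_adj_of_mem_levelSet {x y : V} (hv : v ∈ levelSet G u w (i + 1))
    (hx : x ∈ levelSet G u w i) (hy : y ∈ levelSet G u w i) (hxv : G.Adj x v) (hyv : G.Adj y v)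
    (hlen : 2 * i + 2 < G.girth) : x = y := by
  obtain ⟨p, hp, hpw, rfl⟩ := hx
  obtain ⟨q, hq, hqw, hl⟩ := hy
  have h1 := concat_isPath_of_levelSet hp hpw hv hxv (by omega)
  have h2 := concat_isPath_of_levelSet hq hqw (hl ▸ hv) hyv (by omega)
  have := h1.eq_of_length_add_length_lt_girth_s11 h2 (by simp; omega)
  simpa using congrArg Walk.penultimate this

/-- Each vertex `y` of level `m + 1` together with two distinct neighbours in level `m`
yields a girth-cycle through `u` that avoids `w`. -/
theorem exists_isCycle_of_adj_levelSet {m : ℕ} (hg : G.girth = 2 * m + 2) (hm : 1 ≤ m) {a a' y : V}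
    (hy : y ∈ levelSet G u w (m + 1)) (ha : a ∈ levelSet G u w m) (ha' : a' ∈ levelSet G u w m)
    (hay : G.Adj a y) (hay' : G.Adj a' y) (hne : a ≠ a') :
    ∃ c : G.Walk u u, c.IsCycle ∧ c.length = 2 * m + 2 ∧ s(u, w) ∉ c.edges ∧
      c.getVert m = a ∧ c.getVert (m + 1) = y ∧ c.getVert (m + 2) = a' := by
  obtain ⟨p, hp, hpw, rfl⟩ := ha
  obtain ⟨q, hq, hqw, hl⟩ := ha'
  have h1 := concat_isPath_of_levelSet hp hpw hy hay (by omega)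
  have h2 := (concat_isPath_of_levelSet hq hqw (hl ▸ hy) hay' (by omega)).reverse
  rw [Walk.reverse_concat] at h2
  have hyw : w ≠ y := by
    rintro rfl
    exact notMem_levelSet hy
  have hlen : ((p.concat hay).append (Walk.cons hay'.symm q.reverse)).length =
      2 * p.length + 2 := by
    simp; omega
  refine ⟨(p.concat hay).append (Walk.cons hay'.symm q.reverse), ?_, hlen, fun he => ?_, ?_, ?_, ?_⟩
  · refine IsNonbacktracking.isCycle_of_length_eq_girth ?_ (by omega) (by omega)
    refine (IsNonbacktracking.of_isPath h1).append_cons (IsNonbacktracking.of_isPath h2) fun he => ?_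
    have := h1.eq_penultimate_of_mem_edges he
    rw [Walk.penultimate_concat] at this
    exact hne this.symm
  · have := Walk.snd_mem_support_of_mem_edges _ he
    simp [Walk.support_append, Walk.support_concat, hpw, hqw, hyw] at this
  · simp [Walk.getVert_append, Walk.concat_eq_append]
  · simp [Walk.getVert_append, Walk.concat_eq_append]
  · simp [Walk.getVert_append, Walk.concat_eq_append]

end levelSet

section counting

open scoped Classical in
/-- The finite version of `levelSet`. -/
noncomputable def levelFinset {V : Type*} [Fintype V] (G : SimpleGraph V) (u w : V) (i : ℕ) :
    Finset V :=
  {v | v ∈ levelSet G u w i}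

variable {V : Type*} [Fintype V] {G : SimpleGraph V} {u w v : V} {i k m : ℕ}

@[simp]
theorem mem_levelFinset : v ∈ levelFinset G u w i ↔ v ∈ levelSet G u w i := by
  simp [levelFinset]

open scoped Classical in
theorem card_levelFinset_succ_adj (hreg : ∀ x, Nat.card (G.neighborSet x) = k) (huw : G.Adj u w)
    (hv : v ∈ levelSet G u w i) (h1 : i + 2 < G.girth) (h2 : 2 * i < G.girth) :
    (Finset.bipartiteAbove G.Adj (levelFinset G u w (i + 1)) v).card = k - 1 := by
  obtain ⟨x, hx, hiff⟩ := exists_forall_mem_levelSet_succ_iff huw hv h1 h2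
  have : Finset.bipartiteAbove G.Adj (levelFinset G u w (i + 1)) v =
      (G.neighborFinset v).erase x := by
    ext y
    simp only [Finset.mem_bipartiteAbove, mem_levelFinset, Finset.mem_erase, mem_neighborFinset]
    exact ⟨fun ⟨h, h'⟩ => ⟨(hiff y h').1 h, h'⟩, fun ⟨h, h'⟩ => ⟨(hiff y h').2 h, h'⟩⟩
  rw [this, Finset.card_erase_of_mem (by simpa using hx), ← hreg v, Nat.card_eq_fintype_card,
    card_neighborSet_eq_degree, card_neighborFinset_eq_degree]

theorem card_levelFinset (hreg : ∀ x, Nat.card (G.neighborSet x) = k) (huw : G.Adj u w)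
    (hg : G.girth = 2 * m + 2) (him : i ≤ m) : (levelFinset G u w i).card = (k - 1) ^ i := by
  classical
  induction i with
  | zero =>
    have : levelFinset G u w 0 = {u} := by
      ext v
      simp [levelSet_zero huw.ne]
    simp [this]
  | succ i ih =>
    have := Finset.card_mul_eq_card_mul (s := levelFinset G u w i)
      (t := levelFinset G u w (i + 1)) (m := k - 1) (n := 1) G.Adj
      (fun a ha => card_levelFinset_succ_adj hreg huw (mem_levelFinset.1 ha) (by omega) (by omega))
      (fun b hb => ?_)
    · rw [pow_succ, ← ih (by omega), this, mul_one]
    · rw [mem_levelFinset] at hb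
      obtain ⟨x, hx, hxb⟩ := exists_adj_mem_levelSet hb
      rw [Finset.card_eq_one]
      refine ⟨x, Finset.eq_singleton_iff_unique_mem.2 ⟨?_, fun y hy => ?_⟩⟩
      · simp [Finset.mem_bipartiteBelow, hx, hxb]
      · rw [Finset.mem_bipartiteBelow, mem_levelFinset] at hy
        exact eq_of_adj_of_mem_levelSet hb hy.1 hx hy.2 hxb (by omega)

theorem finite_setOf_walk_length_eq (u v : V) (n : ℕ) : {p : G.Walk u v | p.length = n}.Finite := by
  classical
  exact Set.toFinite _

open scoped Classical in
theorem sum_offDiag_le_ncard (hg : G.girth = 2 * m + 2) (hm : 1 ≤ m) :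
    ∑ y ∈ levelFinset G u w (m + 1),
      (Finset.bipartiteBelow G.Adj (levelFinset G u w m) y).offDiag.card ≤
    {c : G.Walk u u | c.IsCycle ∧ c.length = 2 * m + 2 ∧ s(u, w) ∉ c.edges}.ncard := by
  rw [← Finset.card_sigma, ← Set.ncard_coe_finset]
  have hfin : {c : G.Walk u u | c.IsCycle ∧ c.length = 2 * m + 2 ∧ s(u, w) ∉ c.edges}.Finite :=
    (finite_setOf_walk_length_eq u u (2 * m + 2)).subset fun c hc => hc.2.1
  refine le_trans (Set.ncard_le_ncard ?_ (hfin.image fun c =>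
    (⟨c.getVert (m + 1), c.getVert m, c.getVert (m + 2)⟩ : Σ _ : V, V × V)))
    (Set.ncard_image_le hfin)
  rintro ⟨y, a, a'⟩ h
  simp only [Finset.coe_sigma, Set.mem_sigma_iff, Finset.mem_coe, mem_levelFinset,
    Finset.mem_offDiag, Finset.mem_bipartiteBelow] at h
  obtain ⟨hy, ⟨ha, hay⟩, ⟨ha', hay'⟩, hne⟩ := h
  obtain ⟨c, h1, h2, h3, rfl, rfl, rfl⟩ :=
    exists_isCycle_of_adj_levelSet hg hm hy ha ha' hay hay' hne
  exact ⟨c, ⟨h1, h2, h3⟩, rfl⟩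

end counting

section edgeCycles

variable {V : Type*} {G : SimpleGraph V} {u w : V} {m : ℕ}

/-- The girth-cycles based at `u` whose first edge is `uw`. -/
def cyclesStarting (huw : G.Adj u w) (n : ℕ) : Set (G.Walk u u) :=
  {c | c.IsCycle ∧ c.length = n ∧ ∃ t, c = Walk.cons huw t}

theorem exists_eq_of_mem_cyclesStarting {huw : G.Adj u w} {c : G.Walk u u}
    (hc : c ∈ cyclesStarting huw (2 * m + 2)) :
    ∃ (b a : V) (q : G.Walk w b) (hba : G.Adj b a) (p : G.Walk u a), q.IsPath ∧ p.IsPath ∧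
      u ∉ q.support ∧ w ∉ p.support ∧ q.length = m ∧ p.length = m ∧
      c = Walk.cons huw (q.append (Walk.cons hba p.reverse)) := by
  obtain ⟨hcyc, hl, t, rfl⟩ := hc
  have ht := ((Walk.cons_isCycle_iff _ _).1 hcyc).1
  rw [Walk.length_cons] at hl
  obtain ⟨b, a, q, hba, r, rfl, hq⟩ := t.exists_eq_append_cons (i := m) (by omega)
  have hnd := ht.support_nodup
  rw [Walk.support_append, Walk.support_cons, List.tail_cons, List.nodup_append'] at hnd
  refine ⟨b, a, q, hba, r.reverse, ht.of_append_left, ht.of_append_right.of_cons.reverse,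
    fun h => hnd.2.2 h r.end_mem_support, fun h => hnd.2.2 q.start_mem_support (by simpa using h),
    hq, ?_, by simp⟩
  simp at hl ⊢
  omega

theorem ncard_cyclesStarting (hg : G.girth = 2 * m + 2) (hm : 1 ≤ m) (huw : G.Adj u w) :
    (cyclesStarting huw (2 * m + 2)).ncard =
      {x : V × V | x.1 ∈ levelSet G u w m ∧ x.2 ∈ levelSet G w u m ∧ G.Adj x.1 x.2}.ncard := by
  refine Set.BijOn.ncard_eq (f := fun c => (c.getVert (m + 2), c.getVert (m + 1)))
    ⟨fun c hc => ?_, fun c hc c' hc' heq => ?_, ?_⟩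
  · obtain ⟨b, a, q, hba, p, hq, hp, hqu, hpw, rfl, hpl, rfl⟩ := exists_eq_of_mem_cyclesStarting hc
    have h1 : (Walk.cons huw (q.append (Walk.cons hba p.reverse))).getVert (q.length + 2) = a := by
      simp [Walk.getVert_append]
    have h2 : (Walk.cons huw (q.append (Walk.cons hba p.reverse))).getVert (q.length + 1) = b := by
      simp [Walk.getVert_append]
    simp only [h1, h2]
    exact ⟨⟨p, hp, hpw, hpl⟩, ⟨q, hq, hqu, rfl⟩, hba.symm⟩
  · obtain ⟨b, a, q, hba, p, hq, hp, hqu, hpw, rfl, hpl, rfl⟩ := exists_eq_of_mem_cyclesStarting hc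
    obtain ⟨b', a', q', hba', p', hq', hp', hqu', hpw', hl', hpl', rfl⟩ :=
      exists_eq_of_mem_cyclesStarting hc'
    simp only [Walk.getVert_cons_succ, Walk.getVert_append, ← hl', Prod.mk.injEq] at heq
    simp [hl'] at heq
    obtain ⟨rfl, rfl⟩ := heq
    rw [hp.eq_of_length_add_length_lt_girth_s11 hp' (by omega),
      hq.eq_of_length_add_length_lt_girth_s11 hq' (by omega)]
  · rintro ⟨a, b⟩ ⟨⟨p, hp, hpw, hpl⟩, ⟨q, hq, hqu, rfl⟩, hab⟩
    dsimp only at p q hab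
    have hQ : (Walk.cons huw q).IsPath := (Walk.cons_isPath_iff _ _).2 ⟨hq, hqu⟩
    have hb : b ∉ p.support := fun h => by
      obtain ⟨j, hj, hbj⟩ := exists_mem_levelSet_of_mem_support hp hpw h
      exact notMem_levelSet_swap huw hbj (by omega) ⟨q, hq, hqu, rfl⟩
    have ha : a ∉ (Walk.cons huw q).support := fun h => by
      rw [Walk.support_cons, List.mem_cons] at h
      obtain rfl | h := h
      · rw [Walk.isPath_iff_nil, ← Walk.length_eq_zero_iff] at hp
        omega
      · obtain ⟨j, hj, haj⟩ := exists_mem_levelSet_of_mem_support hq hqu h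
        exact notMem_levelSet_swap huw.symm haj (by omega) ⟨p, hp, hpw, hpl⟩
    have hR : (Walk.cons hab.symm p.reverse).IsPath :=
      (Walk.cons_isPath_iff _ _).2 ⟨hp.reverse, by simpa using hb⟩
    have hlen : ((Walk.cons huw q).append (Walk.cons hab.symm p.reverse)).length =
        2 * q.length + 2 := by
      simp; omega
    refine ⟨(Walk.cons huw q).append (Walk.cons hab.symm p.reverse), ⟨?_, hlen, _, rfl⟩, ?_⟩
    · refine IsNonbacktracking.isCycle_of_length_eq_girth ?_ (by omega) (by omega)
      exact (IsNonbacktracking.of_isPath hQ).append_cons (IsNonbacktracking.of_isPath hR) fun he =>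
        ha (Walk.snd_mem_support_of_mem_edges _ he)
    · simp [Walk.getVert_append]

theorem setOf_isCycle_mem_edges_eq (huw : G.Adj u w) (n : ℕ) :
    {c : G.Walk u u | c.IsCycle ∧ c.length = n ∧ s(u, w) ∈ c.edges} =
      cyclesStarting huw n ∪ Walk.reverse '' cyclesStarting huw n := by
  ext c
  constructor
  · rintro ⟨hc, hl, he⟩
    cases c with
    | nil => simp at he
    | @cons _ x _ h t =>
      rw [Walk.edges_cons, List.mem_cons] at he
      by_cases hx : w = x
      · subst hx
        exact Or.inl ⟨hc, hl, t, rfl⟩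
      · have het : s(u, w) ∈ t.edges := he.resolve_left (by simp [hx, huw.ne.symm])
        have ht := ((Walk.cons_isCycle_iff _ _).1 hc).1.reverse
        refine Or.inr ⟨(Walk.cons h t).reverse, ⟨hc.reverse, by simpa using hl, ?_⟩, by simp⟩
        rw [Walk.reverse_cons]
        have het' : s(u, w) ∈ t.reverse.edges := by simpa using het
        generalize t.reverse = r at ht het'
        cases r with
        | nil => simp at het'
        | cons h' r =>
          have := ht.eq_snd_of_mem_edges het'
          rw [Walk.snd_cons] at this
          subst this
          exact ⟨_, rfl⟩
  · rintro (⟨hc, hl, t, rfl⟩ | ⟨_, ⟨hc, hl, t, rfl⟩, rfl⟩)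
    · exact ⟨hc, hl, by simp⟩
    · exact ⟨hc.reverse, by rwa [Walk.length_reverse], by simp⟩

theorem disjoint_cyclesStarting_image_reverse (huw : G.Adj u w) (n : ℕ) :
    Disjoint (cyclesStarting huw n) (Walk.reverse '' cyclesStarting huw n) := by
  rw [Set.disjoint_left]
  rintro _ ⟨hc, -, t, rfl⟩ ⟨_, ⟨hc', -, t', rfl⟩, heq⟩
  have h3 := hc.three_le_length
  rw [Walk.length_cons] at h3
  have he := congrArg Walk.edges heq
  rw [Walk.edges_reverse, Walk.edges_cons, Walk.edges_cons, List.reverse_cons] at he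
  have hnot := ((Walk.cons_isCycle_iff _ _).1 hc).2
  have hlen : t'.edges.length + 1 = t.edges.length + 1 := by
    simpa using congrArg List.length he
  cases hr : t'.edges.reverse with
  | nil =>
    have hnil := congrArg List.length hr
    rw [List.length_reverse, List.length_nil] at hnil
    rw [Walk.length_edges t] at hlen
    omega
  | cons e l =>
    rw [hr, List.cons_append] at he
    apply hnot
    rw [← (List.cons.inj he).2]
    simp

theorem edgeCycleCount_eq [Fintype V] (hg : G.girth = 2 * m + 2) (hm : 1 ≤ m)
    (huw : G.Adj u w) : edgeCycleCount G (2 * m + 2) u w =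
      2 * {x : V × V | x.1 ∈ levelSet G u w m ∧ x.2 ∈ levelSet G w u m ∧ G.Adj x.1 x.2}.ncard := by
  have hfin : (cyclesStarting huw (2 * m + 2)).Finite :=
    (finite_setOf_walk_length_eq u u (2 * m + 2)).subset fun c hc => hc.2.1
  rw [← ncard_cyclesStarting hg hm huw]
  change Set.ncard {c : G.Walk u u | c.IsCycle ∧ c.length = 2 * m + 2 ∧ s(u, w) ∈ c.edges} = _
  rw [setOf_isCycle_mem_edges_eq huw, Set.ncard_union_eq
    (disjoint_cyclesStarting_image_reverse huw _) hfin (hfin.image _),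
    Set.ncard_image_of_injective _ Walk.reverse_injective, ← two_mul]

theorem vertexCycleCount_eq_add [Fintype V] (u w : V) (n : ℕ) : vertexCycleCount G n u =
    edgeCycleCount G n u w +
      {c : G.Walk u u | c.IsCycle ∧ c.length = n ∧ s(u, w) ∉ c.edges}.ncard := by
  have hfin := finite_setOf_walk_length_eq (G := G) u u n
  change Set.ncard {c : G.Walk u u | c.IsCycle ∧ c.length = n} =
    Set.ncard {c : G.Walk u u | c.IsCycle ∧ c.length = n ∧ s(u, w) ∈ c.edges} + _
  rw [← Set.ncard_union_eq _ (hfin.subset fun c hc => hc.2.1) (hfin.subset fun c hc => hc.2.1)]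
  · congr 1
    ext c
    simp only [Set.mem_union, Set.mem_ofPred_eq]
    tauto
  · rw [Set.disjoint_left]
    exact fun c hc hc' => hc'.2.2 hc.2.2

end edgeCycles

section bounds

variable {V : Type*} [Fintype V] {G : SimpleGraph V} {u w : V} {k m : ℕ}

open scoped Classical in
theorem sum_card_levelFinset_inter (huw : G.Adj u w) (hg : G.girth = 2 * m + 2) (hm : 1 ≤ m) :
    ∑ y ∈ levelFinset G u w (m + 1) ∩ levelFinset G w u m,
      (Finset.bipartiteBelow G.Adj (levelFinset G u w m) y).card =
    {x : V × V | x.1 ∈ levelSet G u w m ∧ x.2 ∈ levelSet G w u m ∧ G.Adj x.1 x.2}.ncard := by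
  rw [← Finset.card_sigma, ← Set.ncard_coe_finset]
  refine Set.BijOn.ncard_eq (f := fun x => (x.2, x.1)) ⟨?_, ?_, ?_⟩
  · rintro ⟨y, a⟩ h
    simp only [Finset.coe_sigma, Set.mem_sigma_iff, Finset.mem_coe, Finset.mem_inter,
      mem_levelFinset, Finset.mem_bipartiteBelow] at h
    exact ⟨h.2.1, h.1.2, h.2.2⟩
  · rintro ⟨y, a⟩ - ⟨y', a'⟩ - h
    simp only [Prod.mk.injEq] at h
    rw [h.1, h.2]
  · rintro ⟨a, y⟩ ⟨ha, hy, hay⟩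
    refine ⟨⟨y, a⟩, ?_, rfl⟩
    simp only [Finset.coe_sigma, Set.mem_sigma_iff, Finset.mem_coe, Finset.mem_inter,
      mem_levelFinset, Finset.mem_bipartiteBelow]
    refine ⟨⟨?_, hy⟩, ha, hay⟩
    dsimp only at ha hy hay
    obtain ⟨p, hp, hpw, hl⟩ := ha
    refine ⟨p.concat hay, hp.concat (fun hmem => ?_) hay, fun hmem => ?_, by simp [hl]⟩
    · obtain ⟨j, hj, hyj⟩ := exists_mem_levelSet_of_mem_support hp hpw hmem
      exact notMem_levelSet_swap huw hyj (by omega) hy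
    · rw [Walk.support_concat, List.mem_append, List.mem_singleton] at hmem
      obtain h | rfl := hmem
      · exact hpw h
      · have hw : w ∈ levelSet G w u 0 := by simp [levelSet_zero huw.ne.symm]
        have := eq_of_mem_levelSet hy hw (by omega)
        omega

open scoped Classical in
theorem card_biUnion_levelFinset (hreg : ∀ x, Nat.card (G.neighborSet x) = k) (huw : G.Adj u w)
    (hg : G.girth = 2 * m + 2) :
    ((Finset.range (m + 1)).biUnion (levelFinset G u w)).card =
      ∑ i ∈ Finset.range (m + 1), (k - 1) ^ i := by
  rw [Finset.card_biUnion]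
  · exact Finset.sum_congr rfl fun i hi =>
      card_levelFinset hreg huw hg (by rw [Finset.mem_range] at hi; omega)
  · intro i hi j hj hij
    rw [Finset.mem_coe, Finset.mem_range] at hi hj
    rw [Function.onFun, Finset.disjoint_left]
    intro v hvi hvj
    rw [mem_levelFinset] at hvi hvj
    exact hij (eq_of_mem_levelSet hvi hvj (by omega))

open scoped Classical in
theorem card_sdiff_add_le_card (hreg : ∀ x, Nat.card (G.neighborSet x) = k) (huw : G.Adj u w)
    (hg : G.girth = 2 * m + 2) :
    (levelFinset G u w (m + 1) \ levelFinset G w u m).card +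
      2 * ∑ i ∈ Finset.range (m + 1), (k - 1) ^ i ≤ Fintype.card V := by
  have hdisj : Disjoint ((Finset.range (m + 1)).biUnion (levelFinset G u w))
      ((Finset.range (m + 1)).biUnion (levelFinset G w u)) := by
    rw [Finset.disjoint_left]
    intro v hv hv'
    simp only [Finset.mem_biUnion, Finset.mem_range, mem_levelFinset] at hv hv'
    obtain ⟨i, hi, hv⟩ := hv
    obtain ⟨j, hj, hv'⟩ := hv'
    exact notMem_levelSet_swap huw hv (by omega) hv'
  have hdisj' : Disjoint (levelFinset G u w (m + 1) \ levelFinset G w u m)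
      ((Finset.range (m + 1)).biUnion (levelFinset G u w) ∪
        (Finset.range (m + 1)).biUnion (levelFinset G w u)) := by
    rw [Finset.disjoint_left]
    intro v hv hv'
    simp only [Finset.mem_sdiff, Finset.mem_union, Finset.mem_biUnion, Finset.mem_range,
      mem_levelFinset] at hv hv'
    obtain ⟨i, hi, hv'⟩ | ⟨j, hj, hv'⟩ := hv'
    · have := eq_of_mem_levelSet hv.1 hv' (by omega)
      omega
    · obtain rfl | hjm := eq_or_ne j m
      · exact hv.2 hv'
      · exact notMem_levelSet_swap huw hv.1 (by omega) hv'
  have := Finset.card_le_univ ((levelFinset G u w (m + 1) \ levelFinset G w u m) ∪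
    ((Finset.range (m + 1)).biUnion (levelFinset G u w) ∪
        (Finset.range (m + 1)).biUnion (levelFinset G w u)))
  rw [Finset.card_union_of_disjoint hdisj', Finset.card_union_of_disjoint hdisj,
    card_biUnion_levelFinset hreg huw hg, card_biUnion_levelFinset hreg huw.symm hg] at this
  omega

end bounds

/-- Cauchy–Schwarz estimate for a function `f` on disjoint finite sets `s` and `t`, in the form
needed to count vertices far from an edge. -/
theorem ceil_sq_div_le_card {α : Type*} [DecidableEq α] {s t : Finset α} (hst : Disjoint s t)
    (f : α → ℕ) {K N lam Lam : ℕ} (hK : t.card ≤ K)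
    (hsum : ∑ y ∈ s ∪ t, f y = N) (ht : ∑ y ∈ t, f y = Lam)
    (hle : ∑ y ∈ s ∪ t, f y * (f y - 1) + 2 * Lam ≤ 2 * lam) :
    ⌈((N : ℚ) - Lam) ^ 2 / (2 * (lam : ℚ) - 3 * (Lam : ℚ) + (N : ℚ) -
        2 * ((max 0 ⌈(Lam : ℚ) ^ 2 / (2 * (K : ℚ)) - (Lam : ℚ) / 2⌉ : ℤ) : ℚ))⌉ ≤
      (s.card : ℤ) := by
  have hsq : ∀ r : Finset α, ((∑ y ∈ r, f y * (f y - 1) : ℕ) : ℚ) =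
      ∑ y ∈ r, (f y : ℚ) ^ 2 - ∑ y ∈ r, (f y : ℚ) := fun r => by
    rw [← Finset.sum_sub_distrib, Nat.cast_sum]
    refine Finset.sum_congr rfl fun y _ => ?_
    cases f y with
    | zero => simp
    | succ n => push_cast [Nat.add_sub_cancel]; ring
  have hcs : ∀ r : Finset α, (∑ y ∈ r, (f y : ℚ)) ^ 2 ≤ r.card * ∑ y ∈ r, (f y : ℚ) ^ 2 :=
    fun r => sq_sum_le_card_mul_sum_sq
  rw [Finset.sum_union hst] at hsum hle
  have ht' : ∑ y ∈ t, (f y : ℚ) = Lam := by exact_mod_cast ht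
  have hs' : ∑ y ∈ s, (f y : ℚ) = N - Lam := by
    rw [← hsum, ← ht]
    push_cast
    ring
  have hle' : ((∑ y ∈ s, f y * (f y - 1) : ℕ) : ℚ) + ((∑ y ∈ t, f y * (f y - 1) : ℕ) : ℚ) +
      2 * Lam ≤ 2 * lam := by exact_mod_cast hle
  obtain ⟨e, he⟩ : ∃ e : ℕ, ∑ y ∈ t, f y * (f y - 1) = 2 * e :=
    Finset.dvd_sum fun y _ => (Nat.even_mul_pred_self (f y)).two_dvd
  have hmax : max 0 ⌈(Lam : ℚ) ^ 2 / (2 * (K : ℚ)) - (Lam : ℚ) / 2⌉ ≤ (e : ℤ) := by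
    refine max_le (by positivity) (Int.ceil_le.2 ?_)
    have h1 := hsq t
    rw [he, ht'] at h1
    push_cast at h1 ⊢
    have h2 := hcs t
    rw [ht'] at h2
    have h3 : (Lam : ℚ) ^ 2 ≤ K * ∑ y ∈ t, (f y : ℚ) ^ 2 :=
      h2.trans (by gcongr)
    have h4 : (Lam : ℚ) ^ 2 / (2 * (K : ℚ)) ≤ (∑ y ∈ t, (f y : ℚ) ^ 2) / 2 := by
      refine div_le_of_le_mul₀ (by positivity) (by positivity) ?_
      linarith
    linarith
  have hmax' : ((max 0 ⌈(Lam : ℚ) ^ 2 / (2 * (K : ℚ)) - (Lam : ℚ) / 2⌉ : ℤ) : ℚ) ≤ e := by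
    exact_mod_cast hmax
  rw [hsq s, he, hs'] at hle'
  push_cast at hle'
  have hpos : 0 ≤ ∑ y ∈ s, (f y : ℚ) ^ 2 := by positivity
  have hD : ∑ y ∈ s, (f y : ℚ) ^ 2 ≤ 2 * (lam : ℚ) - 3 * (Lam : ℚ) + (N : ℚ) -
        2 * ((max 0 ⌈(Lam : ℚ) ^ 2 / (2 * (K : ℚ)) - (Lam : ℚ) / 2⌉ : ℤ) : ℚ) := by
    linarith
  refine Int.ceil_le.2 (div_le_of_le_mul₀ (hpos.trans hD) (by positivity) ?_)
  rw [← hs']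
  refine (hcs s).trans ?_
  push_cast at hD ⊢
  gcongr

/-- let `G` be a `vgr(n,k,g,λ)`-graph of even girth `g = 2h`
having an edge contained in exactly `Λ` girth-cycles. Then
`n ≥ 2((k-1)^h - 1)/(k-2) +
  ⌈((k-1)^h - Λ)² / (2λ - 3Λ + (k-1)^h - 2 max(0, ⌈Λ²/(2(k-1)^(h-1)) - Λ/2⌉))⌉`. -/
theorem vgr_even_girth_order_lower_bound_edge {V : Type*} (G : SimpleGraph V)
    (n k g lam Lam h : ℕ) (hk : 3 ≤ k) (hgh : g = 2 * h) (hG : IsVGR G n k g lam)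
    (hedge : ∃ u w : V, G.Adj u w ∧ edgeCycleCount G g u w = 2 * Lam) :
    (n : ℚ) ≥ 2 * (((k : ℚ) - 1) ^ h - 1) / ((k : ℚ) - 2) +
      ((⌈(((k : ℚ) - 1) ^ h - (Lam : ℚ)) ^ 2 /
        (2 * (lam : ℚ) - 3 * (Lam : ℚ) + ((k : ℚ) - 1) ^ h -
          2 * ((max 0 ⌈(Lam : ℚ) ^ 2 / (2 * ((k : ℚ) - 1) ^ (h - 1)) - (Lam : ℚ) / 2⌉ : ℤ) : ℚ))⌉ : ℤ) : ℚ) := by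
  obtain ⟨hfin, hn, hreg, hgirth, hlam⟩ := hG
  obtain ⟨u, w, huw, hLam⟩ := hedge
  have hgirth : G.girth = g := by exact_mod_cast hgirth
  classical
  have := Fintype.ofFinite V
  rw [Nat.card_eq_fintype_card] at hn
  subst hgh
  have hlam := hlam u
  obtain rfl | ⟨m, rfl⟩ : h = 0 ∨ ∃ m, h = m + 1 := by
    cases h with
    | zero => exact Or.inl rfl
    | succ m => exact Or.inr ⟨m, rfl⟩
  · have hvertex : vertexCycleCount G (2 * 0) u = 0 := by
      have hempty : IsEmpty {p : G.Walk u u // p.IsCycle ∧ p.length = 2 * 0} :=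
        ⟨fun p => by have := p.2.1.three_le_length; have := p.2.2; omega⟩
      exact Nat.card_of_isEmpty
    have hedge := vertexCycleCount_eq_add (G := G) u w (2 * 0)
    have h1 : lam = 0 := by omega
    have h2 : Lam = 0 := by omega
    have : 1 ≤ n := hn ▸ Fintype.card_pos_iff.2 ⟨u⟩
    simpa [h1, h2] using this
  have hm : 1 ≤ m := by
    have := three_le_girth (G := G) fun h => by
      have := girth_eq_zero.2 h
      omega
    omega
  rw [mul_add, mul_one] at hgirth hlam hLam
  have hedgeEq := edgeCycleCount_eq hgirth hm huw
  have hvertexEq := vertexCycleCount_eq_add (G := G) u w (2 * m + 2)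
  have hoff := sum_offDiag_le_ncard (u := u) (w := w) hgirth hm
  have hinter := sum_card_levelFinset_inter huw hgirth hm
  have hcard := card_sdiff_add_le_card hreg huw hgirth
  have hK : (levelFinset G u w (m + 1) ∩ levelFinset G w u m).card ≤ (k - 1) ^ m :=
    (Finset.card_le_card Finset.inter_subset_right).trans
      (card_levelFinset hreg huw.symm hgirth le_rfl).le
  have hsum : ∑ y ∈ levelFinset G u w (m + 1),
      (Finset.bipartiteBelow G.Adj (levelFinset G u w m) y).card = (k - 1) ^ (m + 1) := by
    rw [← Finset.sum_card_bipartiteAbove_eq_sum_card_bipartiteBelow, Finset.sum_congr rfl fun a ha =>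
      card_levelFinset_succ_adj hreg huw (mem_levelFinset.1 ha) (by omega) (by omega),
      Finset.sum_const, card_levelFinset hreg huw hgirth le_rfl, smul_eq_mul, pow_succ]
  have hunion := Finset.sdiff_union_inter (levelFinset G u w (m + 1)) (levelFinset G w u m)
  have hceil := ceil_sq_div_le_card (K := (k - 1) ^ m) (N := (k - 1) ^ (m + 1)) (lam := lam)
    (Lam := Lam) (Finset.disjoint_sdiff_inter (levelFinset G u w (m + 1)) (levelFinset G w u m))
    (fun y => (Finset.bipartiteBelow G.Adj (levelFinset G u w m) y).card) hK
    (by rw [hunion, hsum]) (by omega) (by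
      rw [hunion]
      simp only [Finset.offDiag_card, ← Nat.mul_sub_one] at hoff
      omega)
  have hk1 : ((k - 1 : ℕ) : ℚ) = (k : ℚ) - 1 := by
    push_cast [Nat.cast_sub (show 1 ≤ k by omega)]
    ring
  rw [Nat.add_sub_cancel, ← hk1]
  have hgeom : 2 * (((k - 1 : ℕ) : ℚ) ^ (m + 1) - 1) / ((k : ℚ) - 2) =
      2 * ∑ i ∈ Finset.range (m + 1), ((k - 1 : ℕ) : ℚ) ^ i := by
    have hk2 : (3 : ℚ) ≤ k := by exact_mod_cast hk
    rw [geom_sum_eq (by rw [hk1]; linarith), hk1, mul_div_assoc]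
    ring_nf
  rw [hgeom]
  have hcard' : ((levelFinset G u w (m + 1) \ levelFinset G w u m).card : ℚ) +
      2 * ∑ i ∈ Finset.range (m + 1), ((k - 1 : ℕ) : ℚ) ^ i ≤ n := by
    rw [← hn]
    exact_mod_cast hcard
  rw [Nat.cast_pow, Nat.cast_pow] at hceil
  have hceil' := (Int.cast_le (R := ℚ)).2 hceil
  rw [Int.cast_natCast] at hceil'
  linarith
end

section
/- Let g, k, λ be integers, let G′ be a vgr(v,k,g,λ)-graph, and let G be a subgraph of G′ (on the same vertex set, with girth of G at least g where G contains cycles only of length ≥ g through the relevant vertices). For a vertex u, let cyc(G,g,u) denote the number of cycles of length g in G containing u. If u ∈ V(G) has degree k in G, then it is NOT the case that (k−2)λ + 2·cyc(G,g,u) − Σ_{u′ ∈ N_G(u)} cyc(G,g,u′) < 0, and it is NOT the case that simultaneously (2−k)λ + Σ_{u′ ∈ N_G(u)} cyc(G,g,u′) − 2·max_{u′ ∈ N_G(u)} cyc(G,g,u′) ≥ 0 and (k−2)λ + cyc(G,g,u) − Σ_{u′ ∈ N_G(u)} cyc(G,g,u′) + max_{u′ ∈ N_G(u)} cyc(G,g,u′)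 < 0. In other words, a graph G containing such a vertex u cannot occur as a subgraph of any vgr(v,k,g,λ)-graph. -/
open SimpleGraph

/-- `cyc G g u` is the number of cycles of length `g` in `G` containing the
vertex `u` (each such cycle corresponds to exactly two closed cycle-walks
based at `u`, so the division by `2` is exact). -/
noncomputable def cyc {V : Type*} (G : SimpleGraph V) (g : ℕ) (u : V) : ℕ :=
  vertexCycleCount G g u / 2

namespace SimpleGraph

variable {V : Type*}

/-- The closed walks of length `g` based at `x` that are cycles. -/
def cycleWalks (G : SimpleGraph V) (g : ℕ) (x : V) : Set (G.Walk x x) :=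
  {p | p.IsCycle ∧ p.length = g}

/-- The closed walks of length `g` based at `x` that are cycles and whose first step leads
to `y`. -/
def cycleWalksVia (G : SimpleGraph V) (g : ℕ) (x y : V) : Set (G.Walk x x) :=
  {p | p ∈ G.cycleWalks g x ∧ p.snd = y}

theorem vertexCycleCount_eq_ncard (G : SimpleGraph V) (g : ℕ) (x : V) :
    vertexCycleCount G g x = (G.cycleWalks g x).ncard := rfl

theorem finite_cycleWalks [Finite V] (G : SimpleGraph V) (g : ℕ) (x : V) :
    (G.cycleWalks g x).Finite := by
  classical
  have := Fintype.ofFinite V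
  exact (Set.toFinite {p : G.Walk x x | p.length = g}).subset fun p hp ↦ hp.2

theorem finite_cycleWalksVia [Finite V] (G : SimpleGraph V) (g : ℕ) (x y : V) :
    (G.cycleWalksVia g x y).Finite :=
  (G.finite_cycleWalks g x).subset fun _ hp ↦ hp.1

theorem reverse_mem_cycleWalks {G : SimpleGraph V} {g : ℕ} {x : V} {p : G.Walk x x} :
    p.reverse ∈ G.cycleWalks g x ↔ p ∈ G.cycleWalks g x := by
  simp [cycleWalks]

theorem mapLe_mem_cycleWalks {G G' : SimpleGraph V} (h : G ≤ G') {g : ℕ} {x : V}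
    {p : G.Walk x x} : p.mapLe h ∈ G'.cycleWalks g x ↔ p ∈ G.cycleWalks g x := by
  simp [cycleWalks]

theorem even_ncard_cycleWalks [Finite V] (G : SimpleGraph V) (g : ℕ) (x : V) :
    Even (G.cycleWalks g x).ncard := by
  rw [Set.ncard_eq_toFinset_card _ (G.finite_cycleWalks g x), ← ZMod.natCast_eq_zero_iff_even,
    Finset.card_eq_sum_ones, Nat.cast_sum]
  refine Finset.sum_involution (fun p _ ↦ p.reverse) (fun _ _ ↦ by decide) (fun p hp _ h ↦ ?_)
    (fun p hp ↦ ?_) (fun p _ ↦ p.reverse_reverse)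
  · have hp' : p ∈ G.cycleWalks g x := by simpa using hp
    apply hp'.1.snd_ne_penultimate
    rw [← Walk.snd_reverse, h]
  · simpa [reverse_mem_cycleWalks] using hp

theorem two_mul_cyc [Finite V] (G : SimpleGraph V) (g : ℕ) (x : V) :
    2 * cyc G g x = (G.cycleWalks g x).ncard := by
  rw [cyc, vertexCycleCount_eq_ncard, Nat.two_mul_div_two_of_even (G.even_ncard_cycleWalks g x)]

theorem ncard_cycleWalks_penultimate (G : SimpleGraph V) (g : ℕ) (x y : V) :
    {p | p ∈ G.cycleWalks g x ∧ p.penultimate = y}.ncard = (G.cycleWalksVia g x y).ncard := by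
  rw [← Set.ncard_image_of_injective _ (Walk.reverse_injective (G := G) (u := x) (v := x))]
  congr 1
  ext p
  constructor
  · rintro ⟨q, hq, rfl⟩
    exact ⟨reverse_mem_cycleWalks.2 hq.1, by rw [Walk.snd_reverse, hq.2]⟩
  · rintro ⟨hp, hy⟩
    exact ⟨p.reverse, ⟨reverse_mem_cycleWalks.2 hp, by rw [Walk.penultimate_reverse, hy]⟩,
      p.reverse_reverse⟩

/-- Each cycle through `x` along the edge `xy` is traversed by two of the cycle walks at `x`, one
starting with that edge and the other ending with it. -/
theorem ncard_cycleWalks_eq_add [Finite V] (G : SimpleGraph V) (g : ℕ) (x y : V) :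
    (G.cycleWalks g x).ncard =
      {p | p ∈ G.cycleWalks g x ∧ p.snd ≠ y ∧ p.penultimate ≠ y}.ncard +
        2 * (G.cycleWalksVia g x y).ncard := by
  have hfin := G.finite_cycleWalks g x
  have hA := hfin.subset (fun p (hp : p ∈ {p | p ∈ G.cycleWalks g x ∧ p.snd ≠ y ∧
    p.penultimate ≠ y}) ↦ hp.1)
  have hB := G.finite_cycleWalksVia g x y
  have hC := hfin.subset (fun p (hp : p ∈ {p | p ∈ G.cycleWalks g x ∧
    p.penultimate = y}) ↦ hp.1)
  have hBC : Disjoint (G.cycleWalksVia g x y)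
      {p | p ∈ G.cycleWalks g x ∧ p.penultimate = y} :=
    Set.disjoint_left.2 fun p hp hp' ↦ hp.1.1.snd_ne_penultimate (hp.2.trans hp'.2.symm)
  have hABC : Disjoint {p | p ∈ G.cycleWalks g x ∧ p.snd ≠ y ∧ p.penultimate ≠ y}
      (G.cycleWalksVia g x y ∪ {p | p ∈ G.cycleWalks g x ∧ p.penultimate = y}) := by
    refine Set.disjoint_left.2 fun p hp hp' ↦ ?_
    rcases hp' with hp' | hp'
    · exact hp.2.1 hp'.2
    · exact hp.2.2 hp'.2
  rw [two_mul]
  nth_rw 2 [← ncard_cycleWalks_penultimate]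
  rw [← Set.ncard_union_eq hBC hB hC, ← Set.ncard_union_eq hABC hA (hB.union hC)]
  congr 1
  ext p
  simp only [cycleWalksVia, Set.mem_union, Set.mem_ofPred_eq]
  tauto

/-- A subgraph has at most as many cycle walks avoiding a given edge as the full graph. -/
theorem ncard_cycleWalks_add_le [Finite V] {G G' : SimpleGraph V} (h : G ≤ G') (g : ℕ)
    (x y : V) :
    (G.cycleWalks g x).ncard + 2 * (G'.cycleWalksVia g x y).ncard ≤
      (G'.cycleWalks g x).ncard + 2 * (G.cycleWalksVia g x y).ncard := by
  have key : {p | p ∈ G.cycleWalks g x ∧ p.snd ≠ y ∧ p.penultimate ≠ y}.ncard ≤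
      {p | p ∈ G'.cycleWalks g x ∧ p.snd ≠ y ∧ p.penultimate ≠ y}.ncard := by
    refine Set.ncard_le_ncard_of_injOn (fun p ↦ p.mapLe h) (fun p hp ↦ ?_)
      (fun p _ q _ hpq ↦ Walk.map_injective_of_injective Function.injective_id x x hpq)
      ((G'.finite_cycleWalks g x).subset fun p hp ↦ hp.1)
    refine ⟨(mapLe_mem_cycleWalks h).2 hp.1, ?_, ?_⟩
    · simpa [Walk.snd, Walk.getVert_map] using hp.2.1
    · simpa [Walk.penultimate, Walk.getVert_map] using hp.2.2
  have h₁ := G.ncard_cycleWalks_eq_add g x y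
  have h₂ := G'.ncard_cycleWalks_eq_add g x y
  omega

/-- Removing the first edge `xy` from a cycle walk leaves a path from `y` to `x` that avoids this
edge. -/
theorem ncard_cycleWalksVia_eq_ncard_paths {G : SimpleGraph V} {x y : V} (h : G.Adj x y) (g : ℕ) :
    (G.cycleWalksVia g x y).ncard =
      {q : G.Walk y x | (q.IsPath ∧ s(x, y) ∉ q.edges) ∧ q.length + 1 = g}.ncard := by
  rw [← Set.ncard_image_of_injective (f := fun q : G.Walk y x ↦ Walk.cons h q) _
    (fun p q hpq ↦ by simpa using hpq)]
  congr 1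
  ext p
  constructor
  · rintro ⟨⟨hp, hg⟩, rfl⟩
    have hcons := p.cons_tail_eq hp.not_nil
    refine ⟨p.tail, ⟨?_, ?_⟩, hcons⟩
    · rwa [← Walk.cons_isCycle_iff _ h, hcons]
    · rw [← hg, ← congrArg Walk.length hcons, Walk.length_cons]
  · rintro ⟨q, ⟨hq, hg⟩, rfl⟩
    exact ⟨⟨(Walk.cons_isCycle_iff q h).2 hq, by simpa using hg⟩, by simp⟩

theorem ncard_cycleWalksVia_comm {G : SimpleGraph V} {x y : V} (h : G.Adj x y) (g : ℕ) :
    (G.cycleWalksVia g x y).ncard = (G.cycleWalksVia g y x).ncard := by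
  rw [ncard_cycleWalksVia_eq_ncard_paths h, ncard_cycleWalksVia_eq_ncard_paths h.symm,
    ← Set.ncard_image_of_injective _ (Walk.reverse_injective (G := G) (u := y) (v := x))]
  congr 1
  ext p
  constructor
  · rintro ⟨q, hq, rfl⟩
    simpa [Sym2.eq_swap] using hq
  · intro hp
    exact ⟨p.reverse, by simpa [Sym2.eq_swap] using hp, p.reverse_reverse⟩

theorem ncard_cycleWalks_eq_sum [Finite V] (G : SimpleGraph V) (g : ℕ) (x : V) (s : Finset V)
    (hs : ∀ y, G.Adj x y → y ∈ s) :
    (G.cycleWalks g x).ncard = ∑ y ∈ s, (G.cycleWalksVia g x y).ncard := by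
  classical
  have hfin := G.finite_cycleWalks g x
  rw [Set.ncard_eq_toFinset_card _ hfin,
    Finset.card_eq_sum_card_fiberwise (f := fun p ↦ p.snd) (t := s) ?_]
  · refine Finset.sum_congr rfl fun y _ ↦ ?_
    rw [← Set.ncard_coe_finset]
    congr 1
    ext p
    simp [cycleWalksVia]
  · intro p hp
    have hp' : p ∈ G.cycleWalks g x := by simpa using hp
    exact hs _ (p.adj_snd hp'.1.not_nil)

end SimpleGraph

/-- pruning rule: if `G` is a subgraph (on the same vertex set)
of a `vgr(v,k,g,λ)`-graph `G'` and `u` is a vertex of degree `k` in `G`, then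
neither `(k-2)λ + 2·cyc(G,g,u) - ∑_{u'∈N_G(u)} cyc(G,g,u') < 0` holds, nor do
`(2-k)λ + ∑_{u'∈N_G(u)} cyc(G,g,u') - 2·max_{u'∈N_G(u)} cyc(G,g,u') ≥ 0` and
`(k-2)λ + cyc(G,g,u) - ∑_{u'∈N_G(u)} cyc(G,g,u') + max_{u'∈N_G(u)} cyc(G,g,u') < 0`
hold simultaneously. -/
theorem vgr_subgraph_pruning {V : Type*} [Fintype V] (G G' : SimpleGraph V)
    [DecidableRel G.Adj] (v k g lam : ℕ) (hsub : G ≤ G') (hG' : IsVGR G' v k g lam)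
    (u : V) (hdeg : G.degree u = k) :
    ¬ (((k : ℤ) - 2) * (lam : ℤ) + 2 * (cyc G g u : ℤ) -
        ∑ w ∈ G.neighborFinset u, (cyc G g w : ℤ) < 0) ∧
    ¬ ((2 - (k : ℤ)) * (lam : ℤ) + (∑ w ∈ G.neighborFinset u, (cyc G g w : ℤ)) -
          2 * (((G.neighborFinset u).sup fun w => cyc G g w : ℕ) : ℤ) ≥ 0 ∧
        ((k : ℤ) - 2) * (lam : ℤ) + (cyc G g u : ℤ) -
          (∑ w ∈ G.neighborFinset u, (cyc G g w : ℤ)) +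
          (((G.neighborFinset u).sup fun w => cyc G g w : ℕ) : ℤ) < 0) := by
  classical
  obtain ⟨-, -, hreg, -, hlam⟩ := hG'
  have hN : ∀ y, G'.Adj u y → y ∈ G.neighborFinset u := by
    have hsubset : G.neighborSet u ⊆ G'.neighborSet u := fun _ hy ↦ hsub hy
    have hcard : (G'.neighborSet u).ncard ≤ (G.neighborSet u).ncard := by
      rw [← Nat.card_coe_set_eq, ← Nat.card_coe_set_eq, hreg u, Nat.card_eq_fintype_card,
        G.card_neighborSet_eq_degree, hdeg]
    intro y hy
    rw [mem_neighborFinset, ← mem_neighborSet, Set.eq_of_subset_of_ncard_le hsubset hcard]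
    exact hy
  have hsum := G.ncard_cycleWalks_eq_sum g u (G.neighborFinset u) (by simp)
  have hsum' := G'.ncard_cycleWalks_eq_sum g u (G.neighborFinset u) hN
  have hlam' : ∀ x, (G'.cycleWalks g x).ncard = 2 * lam := hlam
  rw [← two_mul_cyc] at hsum
  rw [hlam'] at hsum'
  have hu (w : V) : cyc G g u + (G'.cycleWalksVia g u w).ncard ≤
      lam + (G.cycleWalksVia g u w).ncard := by
    have := ncard_cycleWalks_add_le hsub g u w
    rw [hlam', ← two_mul_cyc] at this
    omega
  have hw : ∀ w ∈ G.neighborFinset u, cyc G g w + (G'.cycleWalksVia g u w).ncard ≤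
      lam + (G.cycleWalksVia g u w).ncard := by
    intro w hw
    have hadj : G.Adj u w := by simpa using hw
    have := ncard_cycleWalks_add_le hsub g w u
    rw [hlam', ← two_mul_cyc, ← ncard_cycleWalksVia_comm hadj,
      ← ncard_cycleWalksVia_comm (hsub hadj)] at this
    omega
  have hcard : (G.neighborFinset u).card = k := by rw [card_neighborFinset_eq_degree, hdeg]
  have htotal := Finset.sum_le_sum hw
  rw [Finset.sum_add_distrib, Finset.sum_add_distrib, ← hsum, ← hsum', Finset.sum_const, hcard,
    smul_eq_mul] at htotal
  zify at htotal
  refine ⟨by linarith, fun ⟨_, hlt⟩ ↦ ?_⟩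
  rcases (G.neighborFinset u).eq_empty_or_nonempty with hempty | hne
  · rw [hempty, Finset.sum_empty] at hsum hsum'
    have hlam_zero : lam = 0 := by omega
    simp [hempty, hlam_zero] at hlt
    omega
  · obtain ⟨m, hm, hsup⟩ := Finset.exists_mem_eq_sup _ hne fun w ↦ cyc G g w
    rw [hsup] at hlt
    have herase := Finset.sum_le_sum fun w hw' ↦
      hw w (Finset.mem_of_mem_erase (a := m) hw')
    rw [Finset.sum_add_distrib, Finset.sum_add_distrib, Finset.sum_const, smul_eq_mul] at herase
    have hcyc := Finset.add_sum_erase _ (fun w ↦ cyc G g w) hm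
    have hvia := Finset.add_sum_erase _ (fun w ↦ (G.cycleWalksVia g u w).ncard) hm
    have hvia' := Finset.add_sum_erase _ (fun w ↦ (G'.cycleWalksVia g u w).ncard) hm
    have hcard' := Finset.card_erase_add_one hm
    rw [hcard] at hcard'
    have hum := hu m
    zify at herase hcyc hvia hvia' hcard' hum hsum hsum'
    rw [← hcard'] at hlt
    nlinarith
end
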